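/- arXiv:2502.17234 — 4 statements merged into one kernel-verified Lean document; each statement's English description precedes it below -/
import Mathlib

section
/- Let F : (0,∞)² → ℂ be continuous with compact support contained in (0,∞)². Let m1, m2, n1, n2, c1, c2 be positive integers with c2 ∣ c1² and m2·c1² = n2·c2², and set A := √(m1·m2·n1/c2). Then m1^{−2}·m2^{−3/2}·n1^{−2}·n2^{−3/2} · ∫₀^∞ ∫₀^∞ [ y1⁴·y2² ∫_{ℝ³} e(m1·c2·ζ1/(c1²·ξ2·y1·y2)) · e(m2·c1²·ζ2·y2/(c2²·ξ1)) · e(−n1·x1·y1) · F(m1·c2·√ξ1/(c1²·ξ2·y1·y2), m2·c1²·ξ2·y2/(c2²·ξ1)) dx1 dx2 dx4 ] · conj(F(n1·y1, n2·y2)) · y1^{−4}·y2^{−3} · (dy1 dy2)/(y1·y2) = (c1·c2)^{−1} · 𝒥_{αβα,F}(A). -/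
open MeasureTheory

noncomputable section

/-- `e(x) = exp(2πix)`. -/
def e (x : ℝ) : ℂ := Complex.exp (2 * Real.pi * Complex.I * (x : ℂ))

/-- `ξ_{αβα,1}` in coordinates `(x1, x2, x4)`. -/
def ξaba1 (x1 x2 x4 : ℝ) : ℝ := (x1 ^ 2 + 1) ^ 2 + (x1 * x4 + x2) ^ 2

/-- `ξ_{αβα,2}`. -/
def ξaba2 (x1 x2 x4 : ℝ) : ℝ := x1 ^ 2 + x2 ^ 2 + x4 ^ 2 + 1

/-- `ζ_{αβα,1}`. -/
def ζaba1 (x1 x2 x4 : ℝ) : ℝ := x1 * x2 - x4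

/-- `ζ_{αβα,2}`. -/
def ζaba2 (x1 x2 x4 : ℝ) : ℝ :=
  x1 ^ 2 * x2 - x1 ^ 3 * x4 - x1 * x4 ^ 3 - x2 * x4 ^ 2 - 2 * x1 * x4

/-- The integrand of the inner `ℝ³`-integral of `𝒥_{αβα,F}`. -/
def JabaIntegrand (F : ℝ → ℝ → ℂ) (A y1 y2 x1 x2 x4 : ℝ) : ℂ :=
  e (A * ζaba1 x1 x2 x4 / (ξaba2 x1 x2 x4 * y1 * y2)) *
  e (ζaba2 x1 x2 x4 * y2 / ξaba1 x1 x2 x4) *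
  e (-(A * x1 * y1)) *
  F (A * Real.sqrt (ξaba1 x1 x2 x4) / (ξaba2 x1 x2 x4 * y1 * y2))
    (ξaba2 x1 x2 x4 * y2 / ξaba1 x1 x2 x4) *
  (starRingEnd ℂ) (F (A * y1) y2)

/-- The arithmetic transform `𝒥_{αβα,F}(A)`. -/
def Jaba (F : ℝ → ℝ → ℂ) (A : ℝ) : ℂ :=
  ((A : ℂ) ^ 4)⁻¹ *
    ∫ y in Set.Ioi (0 : ℝ) ×ˢ Set.Ioi (0 : ℝ),
      (∫ x : ℝ × ℝ × ℝ, JabaIntegrand F A y.1 y.2 x.1 x.2.1 x.2.2) /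
        ((y.1 : ℂ) * (y.2 : ℂ) ^ 2)

open Set in
/-- Scaling the coordinates of an integral over the open positive quadrant. -/
theorem integral_quadrant_comp_mul {a b : ℝ} (ha : 0 < a) (hb : 0 < b) (f : ℝ × ℝ → ℂ) :
    ∫ y in Ioi (0 : ℝ) ×ˢ Ioi (0 : ℝ), f (a * y.1, b * y.2) =
      ((a * b : ℝ) : ℂ)⁻¹ * ∫ y in Ioi (0 : ℝ) ×ˢ Ioi (0 : ℝ), f y := by
  have hQ : MeasurableSet (Ioi (0 : ℝ) ×ˢ Ioi (0 : ℝ)) := measurableSet_Ioi.prod measurableSet_Ioi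
  let φ : ℝ × ℝ ≃ᵐ ℝ × ℝ :=
    (MeasurableEquiv.mulLeft₀ a ha.ne').prodCongr (MeasurableEquiv.mulLeft₀ b hb.ne')
  have hφ : ∀ y, φ y = (a * y.1, b * y.2) := fun y => rfl
  have hmap : Measure.map φ volume =
      ENNReal.ofReal |a⁻¹| • ENNReal.ofReal |b⁻¹| • (volume : Measure (ℝ × ℝ)) := by
    have h := Measure.map_prod_map (volume : Measure ℝ) (volume : Measure ℝ)
      (measurable_const_mul a) (measurable_const_mul b)
    rw [Real.map_volume_mul_left ha.ne', Real.map_volume_mul_left hb.ne',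
      Measure.prod_smul_left, Measure.prod_smul_right] at h
    exact h.symm
  have key := integral_map_equiv (μ := volume) φ ((Ioi (0 : ℝ) ×ˢ Ioi (0 : ℝ)).indicator f)
  rw [hmap, integral_smul_measure, integral_smul_measure, integral_indicator hQ] at key
  rw [← integral_indicator hQ]
  calc _ = ∫ y, (Ioi (0 : ℝ) ×ˢ Ioi (0 : ℝ)).indicator f (φ y) := by
        congr 1
        ext y
        simp only [indicator_apply, hφ, mem_prod, mem_Ioi, mul_pos_iff_of_pos_left ha,
          mul_pos_iff_of_pos_left hb]
    _ = _ := by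
        rw [← key, ENNReal.toReal_ofReal (abs_nonneg _), ENNReal.toReal_ofReal (abs_nonneg _),
          abs_of_pos (inv_pos.2 ha), abs_of_pos (inv_pos.2 hb), smul_smul, ← mul_inv,
          Complex.real_smul, Complex.ofReal_inv]

/-- The rational exponents of the prefactor collapse under `m₂ c₁² = n₂ c₂²`. -/
theorem rpow_prefactor_eq {m₁ m₂ n₁ n₂ c₁ c₂ : ℝ} (hm₁ : 0 < m₁) (hm₂ : 0 < m₂) (hn₁ : 0 < n₁)
    (hn₂ : 0 < n₂) (hc₁ : 0 < c₁) (hc₂ : 0 < c₂) (h : m₂ * c₁ ^ 2 = n₂ * c₂ ^ 2) :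
    m₁ ^ (-2 : ℝ) * m₂ ^ (-(3 / 2) : ℝ) * n₁ ^ (-2 : ℝ) * n₂ ^ (-(3 / 2) : ℝ) * n₂ =
      (c₁ * c₂)⁻¹ * ((m₁ * m₂ * n₁ / c₂) ^ 2)⁻¹ := by
  have hp : m₂ ^ (-(3 / 2) : ℝ) * n₂ ^ (-(3 / 2) : ℝ) = ((m₂ * c₁ / c₂) ^ 3)⁻¹ := by
    have hsq : m₂ * n₂ = (m₂ * c₁ / c₂) ^ (2 : ℝ) := by
      rw [Real.rpow_two]
      field_simp
      linarith
    rw [← Real.mul_rpow hm₂.le hn₂.le, hsq, ← Real.rpow_mul (by positivity),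
      show (2 : ℝ) * (-(3 / 2)) = -((3 : ℕ) : ℝ) by norm_num, Real.rpow_neg (by positivity),
      Real.rpow_natCast]
  have hn : n₂ = m₂ * c₁ ^ 2 / c₂ ^ 2 := by
    field_simp
    exact h.symm
  have h2 : ∀ x : ℝ, 0 < x → x ^ (-2 : ℝ) = (x ^ 2)⁻¹ := fun x hx => by
    rw [Real.rpow_neg hx.le, Real.rpow_two]
  calc _ = m₁ ^ (-2 : ℝ) * n₁ ^ (-2 : ℝ) *
        (m₂ ^ (-(3 / 2) : ℝ) * n₂ ^ (-(3 / 2) : ℝ)) * n₂ := by ring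
    _ = _ := by
      rw [hp, h2 _ hm₁, h2 _ hn₁, hn]
      field_simp

/-- the Kuznetsov integral identity for the Weyl element `αβα`. -/
theorem kuznetsov_integral_aba (F : ℝ → ℝ → ℂ)
    (hFc : Continuous fun p : ℝ × ℝ => F p.1 p.2)
    (hFs : HasCompactSupport fun p : ℝ × ℝ => F p.1 p.2)
    (hFsub : tsupport (fun p : ℝ × ℝ => F p.1 p.2) ⊆ Set.Ioi 0 ×ˢ Set.Ioi 0)
    (m1 m2 n1 n2 c1 c2 : ℕ) (hm1 : 0 < m1) (hm2 : 0 < m2) (hn1 : 0 < n1)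
    (hn2 : 0 < n2) (hc1 : 0 < c1) (hc2 : 0 < c2)
    (hdvd : c2 ∣ c1 ^ 2) (hcomp : m2 * c1 ^ 2 = n2 * c2 ^ 2)
    (A : ℝ) (hA : A = Real.sqrt ((m1 * m2 * n1 : ℝ) / (c2 : ℝ))) :
    (((m1 : ℝ) ^ (-2 : ℝ) * (m2 : ℝ) ^ (-(3/2) : ℝ) * (n1 : ℝ) ^ (-2 : ℝ) *
        (n2 : ℝ) ^ (-(3/2) : ℝ) : ℝ) : ℂ) *
      ∫ y in Set.Ioi (0 : ℝ) ×ˢ Set.Ioi (0 : ℝ),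
        ((y.1 : ℂ) ^ 4 * (y.2 : ℂ) ^ 2 *
          ∫ x : ℝ × ℝ × ℝ,
            e ((m1 : ℝ) * (c2 : ℝ) * ζaba1 x.1 x.2.1 x.2.2 /
                ((c1 : ℝ) ^ 2 * ξaba2 x.1 x.2.1 x.2.2 * y.1 * y.2)) *
            e ((m2 : ℝ) * (c1 : ℝ) ^ 2 * ζaba2 x.1 x.2.1 x.2.2 * y.2 /
                ((c2 : ℝ) ^ 2 * ξaba1 x.1 x.2.1 x.2.2)) *
            e (-((n1 : ℝ) * x.1 * y.1)) *
            F ((m1 : ℝ) * (c2 : ℝ) * Real.sqrt (ξaba1 x.1 x.2.1 x.2.2) /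
                ((c1 : ℝ) ^ 2 * ξaba2 x.1 x.2.1 x.2.2 * y.1 * y.2))
              ((m2 : ℝ) * (c1 : ℝ) ^ 2 * ξaba2 x.1 x.2.1 x.2.2 * y.2 /
                ((c2 : ℝ) ^ 2 * ξaba1 x.1 x.2.1 x.2.2))) *
        (starRingEnd ℂ) (F ((n1 : ℝ) * y.1) ((n2 : ℝ) * y.2)) *
        ((y.1 : ℂ) ^ (-4 : ℤ) * (y.2 : ℂ) ^ (-3 : ℤ)) / ((y.1 : ℂ) * (y.2 : ℂ))
      = ((c1 * c2 : ℕ) : ℂ)⁻¹ * Jaba F A := by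
  have hm1' : (0 : ℝ) < m1 := by exact_mod_cast hm1
  have hm2' : (0 : ℝ) < m2 := by exact_mod_cast hm2
  have hn1' : (0 : ℝ) < n1 := by exact_mod_cast hn1
  have hn2' : (0 : ℝ) < n2 := by exact_mod_cast hn2
  have hc1' : (0 : ℝ) < c1 := by exact_mod_cast hc1
  have hc2' : (0 : ℝ) < c2 := by exact_mod_cast hc2
  have hcomp' : (m2 : ℝ) * (c1 : ℝ) ^ 2 = n2 * (c2 : ℝ) ^ 2 := by exact_mod_cast hcomp
  have hA0 : 0 < A := by rw [hA]; positivity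
  have hA2 : A ^ 2 = m1 * m2 * n1 / c2 := by rw [hA, Real.sq_sqrt (by positivity)]
  have hAc : (m1 : ℝ) * c2 / c1 ^ 2 = A * (A / (n1 * n2)) := by
    rw [← mul_div_assoc, ← sq, hA2]
    field_simp
    linarith
  have ha : 0 < (n1 : ℝ) / A := by positivity
  let G : ℝ × ℝ → ℂ := fun y =>
    (∫ x : ℝ × ℝ × ℝ, JabaIntegrand F A y.1 y.2 x.1 x.2.1 x.2.2) / ((y.1 : ℂ) * (y.2 : ℂ) ^ 2)
  have hG := integral_quadrant_comp_mul ha hn2' G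
  have hpre := rpow_prefactor_eq hm1' hm2' hn1' hn2' hc1' hc2' hcomp'
  have hQ : MeasurableSet (Set.Ioi (0 : ℝ) ×ˢ Set.Ioi (0 : ℝ)) :=
    measurableSet_Ioi.prod measurableSet_Ioi
  rw [setIntegral_congr_fun (g := fun y : ℝ × ℝ =>
    (((n1 : ℝ) / A * (n2 : ℝ) ^ 2 : ℝ) : ℂ) * G ((n1 : ℝ) / A * y.1, n2 * y.2)) hQ,
    integral_const_mul, hG, ← mul_assoc, ← mul_assoc]
  · rw [Jaba, ← mul_assoc]
    congr 1
    have hscale : (n1 : ℝ) / A * (n2 : ℝ) ^ 2 * (n1 / A * n2)⁻¹ = n2 := by field_simp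
    have hA4 : (A ^ 4)⁻¹ = (((m1 : ℝ) * m2 * n1 / c2) ^ 2)⁻¹ := by
      rw [← hA2]
      ring
    rw [← Complex.ofReal_inv, ← Complex.ofReal_mul, ← Complex.ofReal_mul, mul_assoc _ _ (_⁻¹), hscale, hpre,
      ← hA4]
    push_cast
    rfl
  · rintro ⟨y1, y2⟩ ⟨hy1, hy2⟩
    simp only [Set.mem_Ioi] at hy1 hy2
    have harg : ∀ z w : ℝ, (m1 : ℝ) * c2 * z / ((c1 : ℝ) ^ 2 * w * y1 * y2) =
        A * z / (w * (n1 / A * y1) * (n2 * y2)) := fun z w => by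
      calc _ = (m1 : ℝ) * c2 / c1 ^ 2 * (z / (w * y1 * y2)) := by
            simp only [div_eq_mul_inv, mul_inv]
            ring
        _ = _ := by
            rw [hAc]
            simp only [div_eq_mul_inv, mul_inv, inv_inv]
            ring
    have harg' : ∀ z w : ℝ, (m2 : ℝ) * (c1 : ℝ) ^ 2 * z * y2 / ((c2 : ℝ) ^ 2 * w) =
        z * (n2 * y2) / w := fun z w => by
      rw [hcomp', show (n2 : ℝ) * c2 ^ 2 * z * y2 = c2 ^ 2 * (z * (n2 * y2)) by ring,
        mul_div_mul_left _ _ (by positivity)]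
    have hlin : ∀ z : ℝ, (n1 : ℝ) * z * y1 = A * z * (n1 / A * y1) := fun z => by
      field_simp
    have hlin' : A * ((n1 : ℝ) / A * y1) = n1 * y1 := by field_simp
    simp only [G, JabaIntegrand, harg, harg', hlin, hlin', integral_mul_const]
    have hy1' : (y1 : ℂ) ≠ 0 := by exact_mod_cast hy1.ne'
    have hy2' : (y2 : ℂ) ≠ 0 := by exact_mod_cast hy2.ne'
    have hA' : (A : ℂ) ≠ 0 := by exact_mod_cast hA0.ne'
    have hn1c : (n1 : ℂ) ≠ 0 := by exact_mod_cast hn1.ne'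
    have hn2c : (n2 : ℂ) ≠ 0 := by exact_mod_cast hn2.ne'
    generalize (∫ x : ℝ × ℝ × ℝ, _ : ℂ) = I
    generalize (starRingEnd ℂ) _ = K
    push_cast
    simp only [zpow_neg]
    field_simp

end
end

section
/- For all constants a1, a2, b1, b2 > 0 and every ε > 0 there exist Z0 ≥ 1 and K > 0 such that for all real Z1, Z2, R1, R2 ≥ Z0 satisfying b1·Z2 ≤ Z1 ≤ b2·Z2, the set 𝒳 := { (x1,x2,x4) ∈ ℝ³ : |ξ1(x1,x2,x4) − Z1| ≤ a1·Z1/R1 and |ξ2(x1,x2,x4) − Z2| ≤ a2·Z2/R2 } has Lebesgue measure vol(𝒳) ≤ K · (Z1·Z2)^{1/2} · (R1·R2)^{−1} · (Z1·Z2·R1·R2)^ε. -/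
open MeasureTheory

noncomputable section

open Set

theorem lintegral_comp_le_of_le_deriv {s : Set ℝ} (hs : MeasurableSet s) {f f' : ℝ → ℝ} {L : ℝ}
    (hL : 0 < L) (hf : ∀ u ∈ s, HasDerivAt f (f' u) u) (hinj : InjOn f s)
    (hf' : ∀ u ∈ s, L ≤ |f' u|) (g : ℝ → ENNReal) :
    ∫⁻ u in s, g (f u) ≤ ENNReal.ofReal (1 / L) * ∫⁻ τ, g τ := by
  have h1 : ENNReal.ofReal L * ∫⁻ u in s, g (f u) ≤ ∫⁻ τ, g τ := by
    rw [← lintegral_const_mul' _ _ ENNReal.ofReal_ne_top]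
    calc ∫⁻ u in s, ENNReal.ofReal L * g (f u)
        ≤ ∫⁻ u in s, ENNReal.ofReal |f' u| * g (f u) :=
          setLIntegral_mono' hs fun u hu => by gcongr; exact hf' u hu
      _ = ∫⁻ τ in f '' s, g τ :=
          (lintegral_image_eq_lintegral_abs_deriv_mul hs
            (fun u hu => (hf u hu).hasDerivWithinAt) hinj g).symm
      _ ≤ ∫⁻ τ, g τ := setLIntegral_le_lintegral _ _
  calc ∫⁻ u in s, g (f u)
      = ENNReal.ofReal (1 / L) * (ENNReal.ofReal L * ∫⁻ u in s, g (f u)) := by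
        rw [← mul_assoc, ← ENNReal.ofReal_mul (by positivity), one_div_mul_cancel hL.ne']
        simp
    _ ≤ _ := by gcongr

theorem lintegral_comp_even_le {f f' : ℝ → ℝ} {L m : ℝ} (hL : 0 < L)
    (heven : ∀ u, f (-u) = f u) (hf : ∀ u, HasDerivAt f (f' u) u)
    (hf' : ∀ u, m ≤ u → L ≤ f' u) (g : ℝ → ENNReal) :
    ∫⁻ u in {u | m ≤ |u|}, g (f u) ≤ ENNReal.ofReal (2 / L) * ∫⁻ τ, g τ := by
  have hmono : StrictMonoOn f (Ici m) :=
    strictMonoOn_of_deriv_pos (convex_Ici m) (fun u _ => (hf u).continuousAt.continuousWithinAt)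
      fun u hu => by
        rw [(hf u).deriv]
        exact hL.trans_le (hf' u (interior_subset hu))
  have hfneg : ∀ u, HasDerivAt f (-f' (-u)) u := fun u => by
    have h := (hf (-u)).comp u (hasDerivAt_neg u)
    have e : f ∘ Neg.neg = f := funext heven
    rw [e] at h
    simpa using h
  have hsub : {u : ℝ | m ≤ |u|} ⊆ Ici m ∪ Iic (-m) := fun u hu => by
    rcases le_abs.1 (show m ≤ |u| from hu) with h | h
    · exact Or.inl h
    · exact Or.inr (by simp only [mem_Iic]; linarith)
  calc ∫⁻ u in {u | m ≤ |u|}, g (f u) ≤ ∫⁻ u in Ici m ∪ Iic (-m), g (f u) :=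
        lintegral_mono_set hsub
    _ ≤ (∫⁻ u in Ici m, g (f u)) + ∫⁻ u in Iic (-m), g (f u) := lintegral_union_le _ _ _
    _ ≤ ENNReal.ofReal (1 / L) * (∫⁻ τ, g τ) + ENNReal.ofReal (1 / L) * (∫⁻ τ, g τ) := by
        gcongr
        · exact lintegral_comp_le_of_le_deriv measurableSet_Ici hL (fun u _ => hf u) hmono.injOn
            (fun u hu => (hf' u hu).trans (le_abs_self _)) g
        · refine lintegral_comp_le_of_le_deriv measurableSet_Iic hL (fun u _ => hfneg u) ?_
            (fun u hu => ?_) g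
          · intro u hu v hv huv
            rw [← heven u, ← heven v] at huv
            exact neg_injective (hmono.injOn (mem_Ici.2 (le_neg.1 hu)) (mem_Ici.2 (le_neg.1 hv)) huv)
          · rw [abs_neg]
            exact (hf' (-u) (le_neg.1 hu)).trans (le_abs_self _)
    _ = ENNReal.ofReal (2 / L) * ∫⁻ τ, g τ := by
        rw [← add_mul, ← ENNReal.ofReal_add (by positivity) (by positivity)]
        ring_nf

theorem volume_even_near_le {f f' : ℝ → ℝ} {L m : ℝ} (hL : 0 < L)
    (heven : ∀ u, f (-u) = f u) (hf : ∀ u, HasDerivAt f (f' u) u)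
    (hf' : ∀ u, m ≤ u → L ≤ f' u) (c d : ℝ) :
    volume {u | m ≤ |u| ∧ |f u - c| ≤ d} ≤ ENNReal.ofReal (4 * d / L) := by
  have hcont : Continuous f := continuous_iff_continuousAt.2 fun u => (hf u).continuousAt
  have hball : MeasurableSet {u | |f u - c| ≤ d} :=
    measurableSet_le (by fun_prop) measurable_const
  have h := lintegral_comp_even_le hL heven hf hf' ((Metric.closedBall c d).indicator 1)
  rw [lintegral_indicator_one Metric.isClosed_closedBall.measurableSet, Real.volume_closedBall,
    ← ENNReal.ofReal_mul (by positivity)] at h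
  have e : (fun u => (Metric.closedBall c d).indicator (1 : ℝ → ENNReal) (f u)) =
      {u | |f u - c| ≤ d}.indicator 1 := by
    ext u
    simp [indicator, Real.dist_eq]
  rw [e, lintegral_indicator_one hball, Measure.restrict_apply hball] at h
  convert h using 2
  · ext u
    simp [and_comm]
  · ring

theorem le_rpow_mul_rpow_of_le {e y A B r : ℝ} (he0 : 0 ≤ e) (he1 : e ≤ 1) (hy : 0 ≤ y)
    (hr : 0 < r) (hA : y ≤ A) (hB : y * r ≤ B) : y ≤ A ^ e * B ^ (1 - e) * r ^ (e - 1) := by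
  rcases hy.eq_or_lt with rfl | hy
  · have : 0 ≤ B := by simpa using hB
    positivity
  · have hB0 : 0 < B := (mul_pos hy hr).trans_le hB
    calc y = y ^ e * y ^ (1 - e) := by rw [← Real.rpow_add hy]; simp
      _ ≤ A ^ e * (B / r) ^ (1 - e) := by
          have : 0 ≤ A := hy.le.trans hA
          have h : y ≤ B / r := (le_div_iff₀ hr).2 hB
          gcongr
      _ = A ^ e * B ^ (1 - e) * r ^ (e - 1) := by
          rw [Real.div_rpow hB0.le hr.le, ← neg_sub 1 e, Real.rpow_neg hr.le]
          ring

theorem lintegral_abs_rpow_le {e L : ℝ} (he : 0 < e) (hL : 0 ≤ L) :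
    ∫⁻ x in {x : ℝ | |x| ≤ L}, ENNReal.ofReal (|x| ^ (e - 1)) ≤
      ENNReal.ofReal (2 / e * L ^ e) := by
  have hpos : ∫⁻ x in Icc 0 L, ENNReal.ofReal (|x| ^ (e - 1)) = ENNReal.ofReal (L ^ e / e) := by
    rw [setLIntegral_congr_fun (g := fun x => ENNReal.ofReal (x ^ (e - 1))) measurableSet_Icc
      (fun x hx => by simp only [abs_of_nonneg hx.1])]
    have hint : IntervalIntegrable (fun x : ℝ => x ^ (e - 1)) volume 0 L :=
      intervalIntegral.intervalIntegrable_rpow' (by linarith)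
    rw [setLIntegral_congr Ioc_ae_eq_Icc.symm, ← ofReal_integral_eq_lintegral_ofReal
      ((intervalIntegrable_iff_integrableOn_Ioc_of_le hL).1 hint)
      ((ae_restrict_iff' measurableSet_Ioc).2 (ae_of_all _ fun x hx => by
        have := hx.1.le
        simp only [Pi.zero_apply]
        positivity)),
      ← intervalIntegral.integral_of_le hL, integral_rpow (Or.inl (by linarith))]
    simp [Real.zero_rpow he.ne']
  have hneg : ∫⁻ x in Icc (-L) 0, ENNReal.ofReal (|x| ^ (e - 1)) =
      ∫⁻ x in Icc 0 L, ENNReal.ofReal (|x| ^ (e - 1)) := by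
    have h := (Measure.measurePreserving_neg (volume : Measure ℝ)).setLIntegral_comp_preimage_emb
      (MeasurableEquiv.neg ℝ).measurableEmbedding (fun x => ENNReal.ofReal (|x| ^ (e - 1)))
      (Icc 0 L)
    simpa using h
  calc _ ≤ ∫⁻ x in Icc (-L) 0 ∪ Icc 0 L, ENNReal.ofReal (|x| ^ (e - 1)) := by
        refine lintegral_mono_set fun x hx => ?_
        obtain ⟨h1, h2⟩ := abs_le.1 (show |x| ≤ L from hx)
        rcases le_total x 0 with h | h
        · exact Or.inl ⟨h1, h⟩
        · exact Or.inr ⟨h, h2⟩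
    _ ≤ _ := lintegral_union_le _ _ _
    _ = ENNReal.ofReal (2 / e * L ^ e) := by
        rw [hneg, hpos, ← ENNReal.ofReal_add (by positivity) (by positivity)]
        ring_nf

theorem volume_triple {S : Set (ℝ × ℝ × ℝ)} (hS : MeasurableSet S) :
    volume S = ∫⁻ x, ∫⁻ u, volume {w | (x, u, w) ∈ S} := by
  rw [Measure.volume_eq_prod, Measure.prod_apply hS]
  refine lintegral_congr fun x => ?_
  rw [Measure.volume_eq_prod, Measure.prod_apply (measurable_prodMk_left hS)]
  rfl

theorem lintegral_lintegral_shear {G : ℝ × ℝ → ENNReal} (hG : Measurable G) (a b : ℝ) :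
    ∫⁻ y, ∫⁻ z, G (y + a * z, z - b * (y + a * z)) = ∫⁻ u, ∫⁻ w, G (u, w) := by
  rw [lintegral_lintegral_swap (by fun_prop)]
  calc ∫⁻ z, ∫⁻ y, G (y + a * z, z - b * (y + a * z)) = ∫⁻ z, ∫⁻ u, G (u, z - b * u) :=
        lintegral_congr fun z => lintegral_add_right_eq_self (fun u => G (u, z - b * u)) (a * z)
    _ = ∫⁻ u, ∫⁻ z, G (u, z - b * u) := lintegral_lintegral_swap (by fun_prop)
    _ = ∫⁻ u, ∫⁻ w, G (u, w) :=
        lintegral_congr fun u => lintegral_sub_right_eq_self (fun w => G (u, w)) (b * u)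

/-- The tube after the volume-preserving change of variables
`u = x2 + x1 * x4`, `w = x4 - x1 * u / (x1 ^ 2 + 1)`. -/
def shearedTube (Z1 Z2 D1 D2 : ℝ) : Set (ℝ × ℝ × ℝ) :=
  {p | |(p.1 ^ 2 + 1) ^ 2 + p.2.1 ^ 2 - Z1| ≤ D1 ∧
    |((p.1 ^ 2 + 1) ^ 2 + p.2.1 ^ 2) / (p.1 ^ 2 + 1) + (p.1 ^ 2 + 1) * p.2.2 ^ 2 - Z2| ≤ D2}

theorem measurableSet_shearedTube (Z1 Z2 D1 D2 : ℝ) :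
    MeasurableSet (shearedTube Z1 Z2 D1 D2) := by
  unfold shearedTube
  measurability

theorem volume_tube_eq (Z1 Z2 D1 D2 : ℝ) :
    volume {x : ℝ × ℝ × ℝ | |ξaba1 x.1 x.2.1 x.2.2 - Z1| ≤ D1 ∧
      |ξaba2 x.1 x.2.1 x.2.2 - Z2| ≤ D2} = volume (shearedTube Z1 Z2 D1 D2) := by
  have hS := measurableSet_shearedTube Z1 Z2 D1 D2
  have hX : MeasurableSet {x : ℝ × ℝ × ℝ | |ξaba1 x.1 x.2.1 x.2.2 - Z1| ≤ D1 ∧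
      |ξaba2 x.1 x.2.1 x.2.2 - Z2| ≤ D2} := by
    unfold ξaba1 ξaba2
    measurability
  have hind : ∀ {S : Set (ℝ × ℝ × ℝ)}, MeasurableSet S →
      volume S = ∫⁻ x, ∫⁻ u, ∫⁻ w, S.indicator 1 (x, u, w) := fun {S} h => by
    rw [volume_triple h]
    refine lintegral_congr fun x => lintegral_congr fun u => ?_
    rw [← lintegral_indicator_one]
    · rfl
    · exact (measurable_prodMk_left.comp measurable_prodMk_left) h
  rw [hind hX, hind hS]
  refine lintegral_congr fun x => ?_
  have hG : Measurable fun q : ℝ × ℝ =>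
      (shearedTube Z1 Z2 D1 D2).indicator (1 : ℝ × ℝ × ℝ → ENNReal) (x, q) :=
    (measurable_one.indicator hS).comp measurable_prodMk_left
  rw [← lintegral_lintegral_shear hG x (x / (x ^ 2 + 1))]
  refine lintegral_congr fun y => lintegral_congr fun z => ?_
  have ht : x ^ 2 + 1 ≠ 0 := by positivity
  have e1 : ξaba1 x y z = (x ^ 2 + 1) ^ 2 + (y + x * z) ^ 2 := by
    unfold ξaba1; ring
  have e2 : ξaba2 x y z = ((x ^ 2 + 1) ^ 2 + (y + x * z) ^ 2) / (x ^ 2 + 1) +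
      (x ^ 2 + 1) * (z - x / (x ^ 2 + 1) * (y + x * z)) ^ 2 := by
    unfold ξaba2; field_simp; ring
  simp only [indicator, mem_ofPred_eq, shearedTube, e1, e2, Pi.one_apply]
  congr

theorem volume_w_fiber_le {t Z D : ℝ} (ht : 0 < t) (hZ : 0 < Z) (A : ℝ) :
    volume {w : ℝ | Z / 4 ≤ t * w ^ 2 ∧ |A + t * w ^ 2 - Z| ≤ D} ≤
      ENNReal.ofReal (4 * D / √(t * Z)) := by
  have hs : 0 < √(t * Z) := Real.sqrt_pos.2 (by positivity)
  refine le_trans (measure_mono fun w hw => ?_)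
    (volume_even_near_le (f := fun w => t * w ^ 2) (f' := fun w => t * (2 * w))
      (m := √(t * Z) / (2 * t)) hs (fun w => by ring) (fun w => ?_) (fun w hw => ?_) (Z - A) D)
  · obtain ⟨h1, h2⟩ := hw
    refine ⟨?_, by convert h2 using 2; ring⟩
    rw [div_le_iff₀ (by positivity)]
    refine Real.sqrt_le_iff.2 ⟨by positivity, ?_⟩
    rw [mul_pow, sq_abs]
    nlinarith
  · simpa using (hasDerivAt_pow 2 w).const_mul t
  · rw [div_le_iff₀ (by positivity)] at hw
    linarith

theorem volume_u_fiber_le {Z D t : ℝ} (hZ : 0 < Z) (hD : D ≤ Z / 4) (ht : t ^ 2 ≤ Z / 4) :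
    volume {u : ℝ | |t ^ 2 + u ^ 2 - Z| ≤ D} ≤ ENNReal.ofReal (4 * D / √Z) := by
  have hs : 0 < √Z := Real.sqrt_pos.2 hZ
  refine le_trans (measure_mono fun u hu => ?_)
    (volume_even_near_le (f := fun u => u ^ 2) (f' := fun u => 2 * u) (m := √Z / 2) hs
      (fun u => by ring) (fun u => by simpa using hasDerivAt_pow 2 u) (fun u hu => by linarith)
      (Z - t ^ 2) D)
  have hu : |t ^ 2 + u ^ 2 - Z| ≤ D := hu
  refine ⟨?_, by convert hu using 2; ring⟩
  have := (abs_le.1 hu).1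
  rw [div_le_iff₀ (by positivity)]
  refine Real.sqrt_le_iff.2 ⟨by positivity, ?_⟩
  rw [mul_pow, sq_abs]
  nlinarith

theorem volume_x_fiber_le {Z D : ℝ} (hZ : 16 ≤ Z) (u : ℝ) :
    volume {x : ℝ | √Z < 2 * (x ^ 2 + 1) ∧ |(x ^ 2 + 1) ^ 2 + u ^ 2 - Z| ≤ D} ≤
      ENNReal.ofReal (8 * D / (√√Z * √Z)) := by
  have hs : 4 ≤ √Z := Real.le_sqrt_of_sq_le (by linarith)
  have hss : 0 < √√Z := Real.sqrt_pos.2 (by linarith)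
  have hsq : √√Z ^ 2 = √Z := Real.sq_sqrt (by linarith)
  have e : 8 * D / (√√Z * √Z) = 4 * D / (√√Z * √Z / 2) := by ring
  rw [e]
  refine le_trans (measure_mono fun x hx => ?_)
    (volume_even_near_le (f := fun x => (x ^ 2 + 1) ^ 2)
      (f' := fun x => 2 * (x ^ 2 + 1) * (2 * x)) (m := √√Z / 2) (by positivity)
      (fun x => by ring) (fun x => ?_) (fun x hx => ?_) (Z - u ^ 2) D)
  · obtain ⟨h1, h2⟩ := hx
    refine ⟨?_, by convert h2 using 2; ring⟩
    refine abs_le_of_sq_le_sq' ?_ (abs_nonneg x) |>.2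
    rw [sq_abs, div_pow, hsq]
    linarith
  · simpa using ((hasDerivAt_pow 2 x).add_const 1).fun_pow 2
  · have h0 : 0 ≤ x := le_trans (by positivity) hx
    have h1 : √Z / 4 ≤ x ^ 2 := by
      rw [← hsq]
      nlinarith
    calc √√Z * √Z / 2 = 4 * (√Z / 4) * (√√Z / 2) := by ring
      _ ≤ 4 * (x ^ 2 + 1) * x := by gcongr; linarith
      _ = _ := by ring

theorem volume_shearedTube_medium_le {Z1 Z2 D1 D2 e : ℝ} (he0 : 0 < e) (he1 : e ≤ 1)
    (hZ1 : 1 ≤ Z1) (hZ2 : 0 < Z2) (hD1 : D1 ≤ Z1 / 4) (hD1' : 0 ≤ D1) (hD2' : 0 ≤ D2) :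
    volume (shearedTube Z1 Z2 D1 D2 ∩
        {p | 2 * (p.1 ^ 2 + 1) ≤ √Z1 ∧ Z2 / 4 ≤ (p.1 ^ 2 + 1) * p.2.2 ^ 2}) ≤
      ENNReal.ofReal (32 / e * (D1 / √Z1 * (D2 / √Z2)) * Z1 ^ e) := by
  have hs : 0 < √Z1 := Real.sqrt_pos.2 (by linarith)
  have hs2 : 0 < √Z2 := Real.sqrt_pos.2 hZ2
  have hsq : √Z1 ^ 2 = Z1 := Real.sq_sqrt (by linarith)
  have hle : √Z1 ≤ Z1 := Real.sqrt_le_iff.2 ⟨by linarith, by nlinarith⟩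
  have hX : MeasurableSet {x : ℝ | |x| ≤ Z1} := measurableSet_le (by fun_prop) measurable_const
  have hm : MeasurableSet (shearedTube Z1 Z2 D1 D2 ∩
      {p | 2 * (p.1 ^ 2 + 1) ≤ √Z1 ∧ Z2 / 4 ≤ (p.1 ^ 2 + 1) * p.2.2 ^ 2}) :=
    (measurableSet_shearedTube _ _ _ _).inter (by measurability)
  rw [volume_triple hm]
  have hfib : ∀ x, x ≠ 0 → ∫⁻ u, volume {w | (x, u, w) ∈ shearedTube Z1 Z2 D1 D2 ∩
      {p | 2 * (p.1 ^ 2 + 1) ≤ √Z1 ∧ Z2 / 4 ≤ (p.1 ^ 2 + 1) * p.2.2 ^ 2}} ≤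
      {x : ℝ | |x| ≤ Z1}.indicator (fun x => ENNReal.ofReal (16 * (D1 / √Z1 * (D2 / √Z2))) *
        ENNReal.ofReal (|x| ^ (e - 1))) x := by
    intro x hx0
    by_cases hx : 2 * (x ^ 2 + 1) ≤ √Z1
    · have hxZ : |x| ≤ Z1 := abs_le_of_sq_le_sq (by nlinarith) (by linarith)
      have hU : MeasurableSet {u : ℝ | |(x ^ 2 + 1) ^ 2 + u ^ 2 - Z1| ≤ D1} :=
        measurableSet_le (by fun_prop) measurable_const
      rw [indicator_of_mem (by exact hxZ)]
      have ht : 0 < x ^ 2 + 1 := by positivity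
      have hst : 1 ≤ √(x ^ 2 + 1) := Real.one_le_sqrt.2 (by nlinarith)
      have hsx : |x| ≤ √(x ^ 2 + 1) := Real.le_sqrt_of_sq_le (by rw [sq_abs]; linarith)
      have hr : 1 / √(x ^ 2 + 1) ≤ |x| ^ (e - 1) := by
        have := le_rpow_mul_rpow_of_le (A := 1) (B := 1) he0.le he1
          (y := 1 / √(x ^ 2 + 1)) (by positivity) (abs_pos.2 hx0)
          ((div_le_one (by positivity)).2 hst)
          (by rw [one_div_mul_eq_div]; exact (div_le_one (by positivity)).2 hsx)
        simpa using this
      calc _ ≤ ∫⁻ u in {u : ℝ | |(x ^ 2 + 1) ^ 2 + u ^ 2 - Z1| ≤ D1},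
            ENNReal.ofReal (4 * D2 / √((x ^ 2 + 1) * Z2)) := by
            rw [← lintegral_indicator hU]
            refine lintegral_mono fun u => ?_
            by_cases hu : |(x ^ 2 + 1) ^ 2 + u ^ 2 - Z1| ≤ D1
            · rw [indicator_of_mem (by exact hu)]
              exact (measure_mono fun w hw => And.intro hw.2.2 hw.1.2).trans
                (volume_w_fiber_le ht hZ2 (((x ^ 2 + 1) ^ 2 + u ^ 2) / (x ^ 2 + 1)))
            · rw [indicator_of_notMem (by exact hu)]
              exact (measure_mono_null (fun w hw => hu hw.1.1) measure_empty).le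
        _ ≤ ENNReal.ofReal (4 * D2 / √((x ^ 2 + 1) * Z2)) *
              ENNReal.ofReal (4 * D1 / √Z1) := by
            rw [setLIntegral_const]
            gcongr
            exact volume_u_fiber_le (by linarith) hD1 (by nlinarith)
        _ ≤ _ := by
            rw [← ENNReal.ofReal_mul (by positivity), ← ENNReal.ofReal_mul (by positivity),
              Real.sqrt_mul ht.le]
            refine ENNReal.ofReal_le_ofReal ?_
            calc _ = 16 * (D1 / √Z1 * (D2 / √Z2)) * (1 / √(x ^ 2 + 1)) := by
                  field_simp; ring
              _ ≤ _ := by gcongr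
    · refine le_trans (le_of_eq ?_) bot_le
      refine (lintegral_congr fun u => ?_).trans lintegral_zero
      exact measure_mono_null (fun w hw => hx hw.2.1) measure_empty
  have hae : ∀ᵐ x : ℝ, x ≠ 0 := (measure_eq_zero_iff_ae_notMem).1 (measure_singleton 0)
  calc _ ≤ ∫⁻ x, {x : ℝ | |x| ≤ Z1}.indicator (fun x =>
          ENNReal.ofReal (16 * (D1 / √Z1 * (D2 / √Z2))) * ENNReal.ofReal (|x| ^ (e - 1))) x :=
        lintegral_mono_ae (hae.mono hfib)
    _ ≤ ENNReal.ofReal (16 * (D1 / √Z1 * (D2 / √Z2))) * ENNReal.ofReal (2 / e * Z1 ^ e) := by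
        rw [lintegral_indicator hX, lintegral_const_mul' _ _ ENNReal.ofReal_ne_top]
        gcongr
        exact lintegral_abs_rpow_le he0 (by linarith)
    _ = _ := by
        rw [← ENNReal.ofReal_mul (by positivity)]
        ring_nf

theorem volume_shearedTube_large_le {Z1 Z2 D1 D2 : ℝ}
    (hZ1 : 16 ≤ Z1) (hZ2 : 0 < Z2) (hD1 : D1 ≤ Z1) (hD1' : 0 ≤ D1) (hD2' : 0 ≤ D2) :
    volume (shearedTube Z1 Z2 D1 D2 ∩
        {p | √Z1 < 2 * (p.1 ^ 2 + 1) ∧ Z2 / 4 ≤ (p.1 ^ 2 + 1) * p.2.2 ^ 2}) ≤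
      ENNReal.ofReal (256 * (D1 / √Z1 * (D2 / √Z2))) := by
  have hs : 0 < √Z1 := Real.sqrt_pos.2 (by linarith)
  have hss : 0 < √√Z1 := Real.sqrt_pos.2 hs
  have hs2 : 0 < √Z2 := Real.sqrt_pos.2 hZ2
  have hsq : √Z1 ^ 2 = Z1 := Real.sq_sqrt (by linarith)
  have hssq : √√Z1 ^ 2 = √Z1 := Real.sq_sqrt (by linarith)
  have hm : MeasurableSet (shearedTube Z1 Z2 D1 D2 ∩
      {p | √Z1 < 2 * (p.1 ^ 2 + 1) ∧ Z2 / 4 ≤ (p.1 ^ 2 + 1) * p.2.2 ^ 2}) :=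
    (measurableSet_shearedTube _ _ _ _).inter (by measurability)
  set P : Set (ℝ × ℝ) :=
    {q | √Z1 < 2 * (q.1 ^ 2 + 1) ∧ |(q.1 ^ 2 + 1) ^ 2 + q.2 ^ 2 - Z1| ≤ D1} with hP
  have hPm : MeasurableSet P := by measurability
  have hvolP : volume P ≤ ENNReal.ofReal (32 * D1 / √√Z1) := by
    have hU : MeasurableSet {u : ℝ | |u| ≤ 2 * √Z1} :=
      measurableSet_le (by fun_prop) measurable_const
    rw [Measure.volume_eq_prod, Measure.prod_apply_symm hPm]
    calc _ ≤ ∫⁻ u in {u : ℝ | |u| ≤ 2 * √Z1}, ENNReal.ofReal (8 * D1 / (√√Z1 * √Z1)) := by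
          rw [← lintegral_indicator hU]
          refine lintegral_mono fun u => ?_
          by_cases hu : |u| ≤ 2 * √Z1
          · rw [indicator_of_mem (by exact hu)]
            exact volume_x_fiber_le hZ1 u
          · rw [indicator_of_notMem (by exact hu)]
            refine (measure_mono_null (fun x hx => hu ?_) measure_empty).le
            have h := (abs_le.1 hx.2).2
            refine abs_le_of_sq_le_sq ?_ (by positivity)
            simp only at h
            nlinarith [sq_nonneg (x ^ 2 + 1)]
      _ = ENNReal.ofReal (8 * D1 / (√√Z1 * √Z1)) * ENNReal.ofReal (2 * (2 * √Z1)) := by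
          rw [setLIntegral_const, ← Real.volume_closedBall (0 : ℝ)]
          congr 2
          ext u
          simp
      _ = _ := by
          rw [← ENNReal.ofReal_mul (by positivity)]
          congr 1
          field_simp
          ring
  have hfib : ∀ x u, volume {w | (x, u, w) ∈ shearedTube Z1 Z2 D1 D2 ∩
      {p | √Z1 < 2 * (p.1 ^ 2 + 1) ∧ Z2 / 4 ≤ (p.1 ^ 2 + 1) * p.2.2 ^ 2}} ≤
      ENNReal.ofReal (8 * D2 / (√√Z1 * √Z2)) * P.indicator 1 (x, u) := by
    intro x u
    by_cases hxu : (x, u) ∈ P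
    · have ht : 0 < x ^ 2 + 1 := by positivity
      rw [indicator_of_mem hxu, Pi.one_apply, mul_one]
      refine ((measure_mono fun w hw => And.intro hw.2.2 hw.1.2).trans
        (volume_w_fiber_le ht hZ2 (((x ^ 2 + 1) ^ 2 + u ^ 2) / (x ^ 2 + 1)))).trans
        (ENNReal.ofReal_le_ofReal ?_)
      have hst : √√Z1 / 2 ≤ √(x ^ 2 + 1) := by
        refine Real.le_sqrt_of_sq_le ?_
        have := hxu.1
        rw [div_pow, hssq]
        simp only at this
        linarith
      rw [Real.sqrt_mul ht.le]
      calc 4 * D2 / (√(x ^ 2 + 1) * √Z2) ≤ 4 * D2 / (√√Z1 / 2 * √Z2) := by gcongr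
        _ = _ := by field_simp; ring
    · refine (measure_mono_null (fun w hw => hxu ⟨hw.2.1, hw.1.1⟩) measure_empty).le.trans bot_le
  calc _ = ∫⁻ x, ∫⁻ u, volume {w | (x, u, w) ∈ shearedTube Z1 Z2 D1 D2 ∩
        {p | √Z1 < 2 * (p.1 ^ 2 + 1) ∧ Z2 / 4 ≤ (p.1 ^ 2 + 1) * p.2.2 ^ 2}} := volume_triple hm
    _ ≤ ∫⁻ x, ∫⁻ u, ENNReal.ofReal (8 * D2 / (√√Z1 * √Z2)) * P.indicator 1 (x, u) :=
        lintegral_mono fun x => lintegral_mono fun u => hfib x u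
    _ = ENNReal.ofReal (8 * D2 / (√√Z1 * √Z2)) * volume P := by
        rw [← lintegral_prod (fun q => ENNReal.ofReal (8 * D2 / (√√Z1 * √Z2)) * P.indicator 1 q)
          ((measurable_one.indicator hPm).const_mul _).aemeasurable,
          lintegral_const_mul' _ _ ENNReal.ofReal_ne_top, lintegral_indicator_one hPm,
          Measure.volume_eq_prod]
    _ ≤ ENNReal.ofReal (8 * D2 / (√√Z1 * √Z2)) * ENNReal.ofReal (32 * D1 / √√Z1) := by gcongr
    _ = _ := by
        rw [← ENNReal.ofReal_mul (by positivity)]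
        congr 1
        nth_rewrite 3 [← hssq]
        field_simp
        ring

theorem volume_affine_strip_le {a b c D : ℝ} (hb : b ≠ 0) :
    volume {x : ℝ | |a - b * x + c| ≤ D} ≤ ENNReal.ofReal (2 * D / |b|) := by
  refine (measure_mono (t := Metric.closedBall ((a + c) / b) (D / |b|)) fun x hx => ?_).trans
    (le_of_eq ?_)
  · rw [Metric.mem_closedBall, Real.dist_eq, le_div_iff₀ (abs_pos.2 hb), ← abs_mul, sub_mul,
      div_mul_cancel₀ _ hb, abs_sub_comm, show a + c - x * b = a - b * x + c by ring]
    exact hx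
  · rw [Real.volume_closedBall, mul_div_assoc]

theorem volume_hyperbola_strip_le {e C Z D L : ℝ} (he0 : 0 < e) (he1 : e ≤ 1) (hC : 0 ≤ C)
    (hZ : 0 < Z) (hD : 0 ≤ D) (hL : 0 ≤ L) (c : ℝ) :
    ∫⁻ η in {η : ℝ | |η| ≤ L}, volume {x : ℝ | |x| ≤ C ∧ |η ^ 2 - 2 * √Z * η * x + c| ≤ D} ≤
      ENNReal.ofReal (2 / e * ((2 * C) ^ e * (D / √Z) ^ (1 - e) * L ^ e)) := by
  have hs : 0 < √Z := Real.sqrt_pos.2 hZ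
  have hae : ∀ᵐ η ∂(volume.restrict {η : ℝ | |η| ≤ L}), η ≠ 0 :=
    ae_restrict_of_ae ((measure_eq_zero_iff_ae_notMem).1 (measure_singleton 0))
  have hfib : ∀ η : ℝ, η ≠ 0 → volume {x : ℝ | |x| ≤ C ∧ |η ^ 2 - 2 * √Z * η * x + c| ≤ D} ≤
      ENNReal.ofReal ((2 * C) ^ e * (D / √Z) ^ (1 - e)) * ENNReal.ofReal (|η| ^ (e - 1)) := by
    intro η hη
    have hη' : 0 < |η| := abs_pos.2 hη
    have hb : 2 * √Z * η ≠ 0 := by positivity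
    have h1 : volume {x : ℝ | |x| ≤ C ∧ |η ^ 2 - 2 * √Z * η * x + c| ≤ D} ≤
        ENNReal.ofReal (2 * C) := by
      rw [← Real.volume_closedBall (0 : ℝ)]
      exact measure_mono fun x hx => by simpa using hx.1
    have h2 : volume {x : ℝ | |x| ≤ C ∧ |η ^ 2 - 2 * √Z * η * x + c| ≤ D} ≤
        ENNReal.ofReal (D / √Z / |η|) := by
      refine ((measure_mono fun x hx => hx.2).trans (volume_affine_strip_le hb)).trans
        (le_of_eq ?_)
      rw [abs_mul, abs_of_pos (by positivity : 0 < 2 * √Z)]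
      congr 1
      field_simp
    rw [← ENNReal.ofReal_mul (by positivity)]
    refine (le_min h1 h2).trans ?_
    rw [← ENNReal.ofReal_min]
    refine ENNReal.ofReal_le_ofReal (le_rpow_mul_rpow_of_le he0.le he1 (by positivity) hη'
      (min_le_left _ _) ?_)
    rw [← le_div_iff₀ hη']
    exact min_le_right _ _
  calc _ ≤ ∫⁻ η in {η : ℝ | |η| ≤ L}, ENNReal.ofReal ((2 * C) ^ e * (D / √Z) ^ (1 - e)) *
        ENNReal.ofReal (|η| ^ (e - 1)) := lintegral_mono_ae (hae.mono hfib)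
    _ ≤ ENNReal.ofReal ((2 * C) ^ e * (D / √Z) ^ (1 - e)) *
        ENNReal.ofReal (2 / e * L ^ e) := by
        rw [lintegral_const_mul' _ _ ENNReal.ofReal_ne_top]
        gcongr
        exact lintegral_abs_rpow_le he0 hL
    _ = _ := by
        rw [← ENNReal.ofReal_mul (by positivity)]
        ring_nf

/-- The part of the tube with bounded `x`, in the coordinates `τ = u ^ 2 + (x ^ 2 + 1) ^ 2` and
`η = (x ^ 2 + 1) * w + √Z2 * x`. -/
def hyperbolicTube (Z1 Z2 D1 D C L : ℝ) : Set (ℝ × ℝ × ℝ) :=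
  {p | |p.1 - Z1| ≤ D1 ∧ |p.2.1| ≤ L ∧
    |p.2.2| ≤ C ∧ |p.2.1 ^ 2 - 2 * √Z2 * p.2.1 * p.2.2 + (p.1 - Z2)| ≤ D}

theorem measurableSet_hyperbolicTube (Z1 Z2 D1 D C L : ℝ) :
    MeasurableSet (hyperbolicTube Z1 Z2 D1 D C L) := by
  unfold hyperbolicTube
  measurability

theorem volume_hyperbolicTube_le {e C Z1 Z2 D1 D L : ℝ} (he0 : 0 < e) (he1 : e ≤ 1)
    (hC : 0 ≤ C) (hZ2 : 0 < Z2) (hD : 0 ≤ D) (hL : 0 ≤ L) :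
    volume (hyperbolicTube Z1 Z2 D1 D C L) ≤
      ENNReal.ofReal (4 / e * D1 * ((2 * C) ^ e * (D / √Z2) ^ (1 - e) * L ^ e)) := by
  have hT : MeasurableSet {τ : ℝ | |τ - Z1| ≤ D1} :=
    measurableSet_le (by fun_prop) measurable_const
  have hH : MeasurableSet {η : ℝ | |η| ≤ L} := measurableSet_le (by fun_prop) measurable_const
  rw [volume_triple (measurableSet_hyperbolicTube _ _ _ _ _ _)]
  calc _ ≤ ∫⁻ τ in {τ : ℝ | |τ - Z1| ≤ D1},
        ENNReal.ofReal (2 / e * ((2 * C) ^ e * (D / √Z2) ^ (1 - e) * L ^ e)) := by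
        rw [← lintegral_indicator hT]
        refine lintegral_mono fun τ => ?_
        by_cases hτ : |τ - Z1| ≤ D1
        · rw [indicator_of_mem (by exact hτ)]
          refine le_trans ?_ (volume_hyperbola_strip_le he0 he1 hC hZ2 hD hL (τ - Z2))
          rw [← lintegral_indicator hH]
          refine lintegral_mono fun η => ?_
          by_cases hη : |η| ≤ L
          · rw [indicator_of_mem (by exact hη)]
            exact measure_mono fun x hx => hx.2.2
          · exact (measure_mono_null (fun x hx => hη hx.2.1) measure_empty).le.trans bot_le
        · refine le_trans (le_of_eq ?_) bot_le
          refine (lintegral_congr fun η => ?_).trans lintegral_zero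
          exact measure_mono_null (fun x hx => hτ hx.1) measure_empty
    _ = ENNReal.ofReal (2 / e * ((2 * C) ^ e * (D / √Z2) ^ (1 - e) * L ^ e)) *
        ENNReal.ofReal (2 * D1) := by
        rw [setLIntegral_const, ← Real.volume_closedBall Z1]
        rfl
    _ = _ := by
        rw [← ENNReal.ofReal_mul (by positivity)]
        ring_nf

theorem lintegral_comp_hyperbolic_le {F : ℝ × ℝ × ℝ → ENNReal} (hF : Measurable F) {m : ℝ}
    (hm : 0 < m) (b : ℝ) :
    ∫⁻ x, ∫⁻ u in {u | m ≤ |u|}, ∫⁻ w, F (u ^ 2 + (x ^ 2 + 1) ^ 2, (x ^ 2 + 1) * w + b * x, x) ≤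
      ENNReal.ofReal (1 / m) * ∫⁻ p, F p := by
  have hw : ∀ τ x, ∫⁻ w, F (τ, (x ^ 2 + 1) * w + b * x, x) ≤ ∫⁻ η, F (τ, η, x) := by
    intro τ x
    have ht : x ^ 2 + 1 ≠ 0 := by positivity
    have h := lintegral_comp_le_of_le_deriv (s := univ) MeasurableSet.univ one_pos
      (f := fun w => (x ^ 2 + 1) * w + b * x) (f' := fun _ => x ^ 2 + 1)
      (fun w _ => by simpa using ((hasDerivAt_id w).const_mul (x ^ 2 + 1)).add_const (b * x))
      (fun v _ w _ h => by simpa [ht] using h)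
      (fun w _ => by rw [abs_of_pos (by positivity)]; nlinarith) (fun η => F (τ, η, x))
    simpa using h
  have hu : ∀ x, ∫⁻ u in {u | m ≤ |u|}, ∫⁻ w,
      F (u ^ 2 + (x ^ 2 + 1) ^ 2, (x ^ 2 + 1) * w + b * x, x) ≤
      ENNReal.ofReal (1 / m) * ∫⁻ τ, ∫⁻ η, F (τ, η, x) := by
    intro x
    have h := lintegral_comp_even_le (f := fun u => u ^ 2 + (x ^ 2 + 1) ^ 2)
      (f' := fun u => 2 * u) (L := 2 * m) (m := m) (by positivity) (fun u => by ring)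
      (fun u => by simpa using (hasDerivAt_pow 2 u).add_const ((x ^ 2 + 1) ^ 2))
      (fun u hu => by linarith) (fun τ => ∫⁻ η, F (τ, η, x))
    have e : 2 / (2 * m) = 1 / m := by field_simp
    rw [e] at h
    exact (lintegral_mono fun u => hw _ x).trans h
  calc _ ≤ ∫⁻ x, ENNReal.ofReal (1 / m) * ∫⁻ τ, ∫⁻ η, F (τ, η, x) := lintegral_mono hu
    _ = ENNReal.ofReal (1 / m) * ∫⁻ x, ∫⁻ τ, ∫⁻ η, F (τ, η, x) :=
        lintegral_const_mul' _ _ ENNReal.ofReal_ne_top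
    _ = ENNReal.ofReal (1 / m) * ∫⁻ p, F p := by
        have hmeas : Measurable fun q : ℝ × ℝ => ∫⁻ η, F (q.2, η, q.1) :=
          Measurable.lintegral_prod_right' (f := fun r : (ℝ × ℝ) × ℝ => F (r.1.2, r.2, r.1.1))
            (by fun_prop)
        congr 1
        rw [lintegral_lintegral_swap hmeas.aemeasurable, Measure.volume_eq_prod,
          lintegral_prod _ hF.aemeasurable]
        refine lintegral_congr fun τ => ?_
        rw [lintegral_lintegral_swap (by fun_prop), Measure.volume_eq_prod,
          lintegral_prod _ (by fun_prop)]

theorem volume_shearedTube_small_le {Z1 Z2 D1 D2 C e : ℝ} (he0 : 0 < e) (he1 : e ≤ 1)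
    (hC : 1 ≤ C) (hCZ : C ^ 2 ≤ Z1 / 4) (hZ2 : 0 < Z2) (hD1 : D1 ≤ Z1 / 4)
    (hD2 : D2 ≤ Z2) (hD2' : 0 < D2) :
    volume (shearedTube Z1 Z2 D1 D2 ∩ {p | p.1 ^ 2 + 1 ≤ C}) ≤
      ENNReal.ofReal (8 * C / e * (D1 / √Z1 * (D2 / √Z2)) * (6 * C * (Z2 / D2)) ^ e) := by
  have hZ1 : 0 < Z1 := by nlinarith
  have hs : 0 < √Z1 := Real.sqrt_pos.2 hZ1
  have hs2 : 0 < √Z2 := Real.sqrt_pos.2 hZ2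
  have hsq : √Z1 ^ 2 = Z1 := Real.sq_sqrt hZ1.le
  have hsq2 : √Z2 ^ 2 = Z2 := Real.sq_sqrt hZ2.le
  have hm : MeasurableSet (shearedTube Z1 Z2 D1 D2 ∩ {p | p.1 ^ 2 + 1 ≤ C}) :=
    (measurableSet_shearedTube _ _ _ _).inter (by measurability)
  set H := hyperbolicTube Z1 Z2 D1 (C * D2) C (3 * C * √Z2) with hH
  have hHm : MeasurableSet H := measurableSet_hyperbolicTube _ _ _ _ _ _
  have hU : MeasurableSet {u : ℝ | √Z1 / 2 ≤ |u|} := measurableSet_le measurable_const (by fun_prop)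
  have hmap : ∀ x u w, (x, u, w) ∈ shearedTube Z1 Z2 D1 D2 ∩ {p | p.1 ^ 2 + 1 ≤ C} →
      √Z1 / 2 ≤ |u| ∧
        (u ^ 2 + (x ^ 2 + 1) ^ 2, (x ^ 2 + 1) * w + √Z2 * x, x) ∈ H := by
    rintro x u w ⟨⟨h1, h2⟩, hx⟩
    simp only [mem_ofPred_eq] at h1 h2 hx
    have ht : 0 < x ^ 2 + 1 := by positivity
    have hxC : |x| ≤ C := abs_le_of_sq_le_sq (by nlinarith) (by linarith)
    have ht2 : (x ^ 2 + 1) ^ 2 ≤ C ^ 2 := by gcongr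
    have hτ : 0 ≤ ((x ^ 2 + 1) ^ 2 + u ^ 2) / (x ^ 2 + 1) := by positivity
    refine ⟨?_, by convert h1 using 2; ring, ?_, hxC, ?_⟩
    · have := (abs_le.1 h1).1
      rw [div_le_iff₀ (by positivity)]
      refine Real.sqrt_le_iff.2 ⟨by positivity, ?_⟩
      rw [mul_pow, sq_abs]
      nlinarith
    · have h3 := (abs_le.1 h2).2
      have h4 : |(x ^ 2 + 1) * w| ≤ 2 * C * √Z2 := by
        refine abs_le_of_sq_le_sq ?_ (by positivity)
        rw [mul_pow, mul_pow, hsq2]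
        calc (x ^ 2 + 1) ^ 2 * w ^ 2 = (x ^ 2 + 1) * ((x ^ 2 + 1) * w ^ 2) := by ring
          _ ≤ C * (2 * Z2) := mul_le_mul hx (by linarith) (by positivity) (by linarith)
          _ ≤ _ := by nlinarith [mul_pos hZ2 (by linarith : 0 < C)]
      calc |(x ^ 2 + 1) * w + √Z2 * x| ≤ |(x ^ 2 + 1) * w| + |√Z2 * x| := abs_add_le _ _
        _ ≤ 2 * C * √Z2 + √Z2 * C := by
            rw [abs_mul √Z2, abs_of_pos hs2]
            gcongr
        _ = _ := by ring
    · calc _ = |(x ^ 2 + 1) *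
            (((x ^ 2 + 1) ^ 2 + u ^ 2) / (x ^ 2 + 1) + (x ^ 2 + 1) * w ^ 2 - Z2)| := by
            congr 1
            field_simp
            linear_combination (-(x ^ 2)) * hsq2
        _ ≤ C * D2 := by
            rw [abs_mul, abs_of_pos ht]
            gcongr
  calc _ = ∫⁻ x, ∫⁻ u, volume {w | (x, u, w) ∈ shearedTube Z1 Z2 D1 D2 ∩
        {p | p.1 ^ 2 + 1 ≤ C}} := volume_triple hm
    _ ≤ ∫⁻ x, ∫⁻ u in {u | √Z1 / 2 ≤ |u|}, ∫⁻ w,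
        H.indicator 1 (u ^ 2 + (x ^ 2 + 1) ^ 2, (x ^ 2 + 1) * w + √Z2 * x, x) := by
        refine lintegral_mono fun x => ?_
        rw [← lintegral_indicator hU]
        refine lintegral_mono fun u => ?_
        have hset : MeasurableSet {w : ℝ |
            (u ^ 2 + (x ^ 2 + 1) ^ 2, (x ^ 2 + 1) * w + √Z2 * x, x) ∈ H} := by
          have : Measurable fun w : ℝ =>
            (u ^ 2 + (x ^ 2 + 1) ^ 2, (x ^ 2 + 1) * w + √Z2 * x, x) := by fun_prop
          exact this hHm
        by_cases hu : √Z1 / 2 ≤ |u|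
        · rw [indicator_of_mem (by exact hu)]
          exact (measure_mono fun w hw => (hmap x u w hw).2).trans
            (lintegral_indicator_one hset).symm.le
        · exact (measure_mono_null (fun w hw => hu (hmap x u w hw).1) measure_empty).le.trans bot_le
    _ ≤ ENNReal.ofReal (1 / (√Z1 / 2)) * volume H := by
        rw [← lintegral_indicator_one hHm]
        exact lintegral_comp_hyperbolic_le (measurable_one.indicator hHm) (by positivity) √Z2
    _ ≤ ENNReal.ofReal (1 / (√Z1 / 2)) * ENNReal.ofReal (4 / e * D1 *
        ((2 * C) ^ e * (C * D2 / √Z2) ^ (1 - e) * (3 * C * √Z2) ^ e)) := by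
        gcongr
        exact volume_hyperbolicTube_le he0 he1 (by linarith) hZ2 (by positivity) (by positivity)
    _ = _ := by
        rw [← ENNReal.ofReal_mul (by positivity)]
        congr 1
        have hB : 0 < C * D2 / √Z2 := by positivity
        have key : (2 * C) ^ e * (C * D2 / √Z2) ^ (1 - e) * (3 * C * √Z2) ^ e =
            C * D2 / √Z2 * (6 * C * (Z2 / D2)) ^ e := by
          have : 6 * C * (Z2 / D2) = 2 * C * (3 * C * √Z2) / (C * D2 / √Z2) := by
            field_simp
            linear_combination (-6) * hsq2
          rw [this, Real.div_rpow (by positivity) hB.le,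
            Real.mul_rpow (x := 2 * C) (y := 3 * C * √Z2) (by positivity) (by positivity),
            Real.rpow_sub hB, Real.rpow_one]
          ring
        rw [key]
        field_simp
        ring

theorem shearedTube_subset {Z1 Z2 D1 D2 b C : ℝ} (hZ2 : 0 < Z2) (hD1 : D1 ≤ Z1 / 4)
    (hD2 : D2 ≤ Z2 / 4) (hZ : Z1 ≤ b * Z2) (hb : 4 * b ≤ C) :
    shearedTube Z1 Z2 D1 D2 ⊆
      shearedTube Z1 Z2 D1 D2 ∩ {p | p.1 ^ 2 + 1 ≤ C} ∪
      (shearedTube Z1 Z2 D1 D2 ∩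
        {p | 2 * (p.1 ^ 2 + 1) ≤ √Z1 ∧ Z2 / 4 ≤ (p.1 ^ 2 + 1) * p.2.2 ^ 2} ∪
      shearedTube Z1 Z2 D1 D2 ∩
        {p | √Z1 < 2 * (p.1 ^ 2 + 1) ∧ Z2 / 4 ≤ (p.1 ^ 2 + 1) * p.2.2 ^ 2}) := by
  rintro ⟨x, u, w⟩ h
  by_cases hx : x ^ 2 + 1 ≤ C
  · exact Or.inl ⟨h, hx⟩
  · have ht : 0 < x ^ 2 + 1 := by positivity
    have hq : ((x ^ 2 + 1) ^ 2 + u ^ 2) / (x ^ 2 + 1) ≤ Z2 / 2 := by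
      have h1 := (abs_le.1 h.1).2
      simp only at h1
      rw [div_le_iff₀ ht]
      nlinarith
    have hw : Z2 / 4 ≤ (x ^ 2 + 1) * w ^ 2 := by
      have h2 := (abs_le.1 h.2).1
      simp only at h2
      linarith
    rcases le_or_gt (2 * (x ^ 2 + 1)) √Z1 with h3 | h3
    · exact Or.inr (Or.inl ⟨h, h3, hw⟩)
    · exact Or.inr (Or.inr ⟨h, h3, hw⟩)

/-- the tube-volume bound for the Weyl element `αβα`. -/
theorem tube_volume_aba (a1 a2 b1 b2 ε : ℝ)
    (ha1 : 0 < a1) (ha2 : 0 < a2) (hb1 : 0 < b1) (hb2 : 0 < b2) (hε : 0 < ε) :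
    ∃ Z0 ≥ (1:ℝ), ∃ K > (0:ℝ), ∀ Z1 Z2 R1 R2 : ℝ,
      Z0 ≤ Z1 → Z0 ≤ Z2 → Z0 ≤ R1 → Z0 ≤ R2 →
      b1 * Z2 ≤ Z1 → Z1 ≤ b2 * Z2 →
      volume {x : ℝ × ℝ × ℝ |
          |ξaba1 x.1 x.2.1 x.2.2 - Z1| ≤ a1 * Z1 / R1 ∧
          |ξaba2 x.1 x.2.1 x.2.2 - Z2| ≤ a2 * Z2 / R2} ≤
        ENNReal.ofReal
          (K * Real.sqrt (Z1 * Z2) / (R1 * R2) * (Z1 * Z2 * R1 * R2) ^ ε) := by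
  set C := 4 * b2 + 1 with hC
  have hC1 : 1 ≤ C := by linarith
  set e := min ε 1 with he
  have he0 : 0 < e := lt_min hε one_pos
  have he1 : e ≤ 1 := min_le_right _ _
  refine ⟨16 + 4 * C ^ 2 + 4 * a1 + 4 * a2, by nlinarith,
    (8 * C / e * (6 * C / a2) ^ e + 32 / e + 256) * (a1 * a2), by positivity, ?_⟩
  intro Z1 Z2 R1 R2 hZ1 hZ2 hR1 hR2 _ hZ
  have hCsq : 0 ≤ C ^ 2 := sq_nonneg C
  have hZ1' : 16 ≤ Z1 := by linarith
  have hZ2' : 16 ≤ Z2 := by linarith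
  have hR1' : 16 ≤ R1 := by linarith
  have hR2' : 16 ≤ R2 := by linarith
  have hD1 : a1 * Z1 / R1 ≤ Z1 / 4 := by
    rw [div_le_div_iff₀ (by positivity) (by positivity)]
    nlinarith
  have hD2 : a2 * Z2 / R2 ≤ Z2 / 4 := by
    rw [div_le_div_iff₀ (by positivity) (by positivity)]
    nlinarith
  set D1 := a1 * Z1 / R1 with hD1e
  set D2 := a2 * Z2 / R2 with hD2e
  have hD1p : 0 < D1 := by positivity
  have hD2p : 0 < D2 := by positivity
  set E := (Z1 * Z2 * R1 * R2) ^ ε with hE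
  have hle : ∀ r : ℝ, 1 ≤ r → r ≤ Z1 * Z2 * R1 * R2 → r ^ e ≤ E := fun r h1 h2 =>
    (Real.rpow_le_rpow_of_exponent_le h1 (min_le_left ε 1)).trans
      (Real.rpow_le_rpow (by linarith) h2 hε.le)
  have hEZ : Z1 ^ e ≤ E := hle Z1 (by linarith) <| by
    rw [mul_assoc, mul_assoc]
    have := one_le_mul_of_one_le_of_one_le (by linarith : 1 ≤ R1) (by linarith : 1 ≤ R2)
    exact le_mul_of_one_le_right (by linarith)
      (one_le_mul_of_one_le_of_one_le (by linarith) this)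
  have hER : R2 ^ e ≤ E := hle R2 (by linarith) <| by
    have := one_le_mul_of_one_le_of_one_le (by linarith : 1 ≤ Z1) (by linarith : 1 ≤ Z2)
    exact le_mul_of_one_le_left (by linarith)
      (one_le_mul_of_one_le_of_one_le this (by linarith))
  have hE1 : 1 ≤ E := (Real.one_le_rpow (by linarith) he0.le).trans hEZ
  have hmain : D1 / √Z1 * (D2 / √Z2) = a1 * a2 * √(Z1 * Z2) / (R1 * R2) := by
    have h1 : √Z1 ^ 2 = Z1 := Real.sq_sqrt (by linarith)
    have h2 : √Z2 ^ 2 = Z2 := Real.sq_sqrt (by linarith)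
    have h3 : 0 < √Z1 := Real.sqrt_pos.2 (by linarith)
    have h4 : 0 < √Z2 := Real.sqrt_pos.2 (by linarith)
    rw [hD1e, hD2e, Real.sqrt_mul (by linarith)]
    field_simp
    rw [h1, h2]
  rw [volume_tube_eq]
  refine (measure_mono (shearedTube_subset (by linarith) hD1 hD2 hZ
    (by linarith : 4 * b2 ≤ C))).trans ?_
  refine (measure_union_le _ _).trans ((add_le_add
    (volume_shearedTube_small_le he0 he1 hC1 (by linarith) (by linarith) hD1
      (by linarith) hD2p)
    ((measure_union_le _ _).trans (add_le_add
      (volume_shearedTube_medium_le he0 he1 (by linarith) (by linarith) hD1 hD1p.le hD2p.le)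
      (volume_shearedTube_large_le hZ1' (by linarith) (by linarith) hD1p.le hD2p.le)))).trans ?_)
  have hR : (6 * C * (Z2 / D2)) ^ e = (6 * C / a2) ^ e * R2 ^ e := by
    rw [← Real.mul_rpow (by positivity) (by positivity)]
    congr 1
    rw [hD2e]
    field_simp
  rw [← ENNReal.ofReal_add (by positivity) (by positivity),
    ← ENNReal.ofReal_add (by positivity) (by positivity), hR, hmain]
  refine ENNReal.ofReal_le_ofReal ?_
  set M := a1 * a2 * √(Z1 * Z2) / (R1 * R2) with hM
  have hM0 : 0 ≤ M := by positivity
  calc _ ≤ 8 * C / e * M * ((6 * C / a2) ^ e * E) + (32 / e * M * E + 256 * M * E) := by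
        gcongr ?_ + (?_ + ?_)
        · gcongr
        · gcongr
        · rw [mul_assoc]
          gcongr
          exact le_mul_of_one_le_right (by positivity) hE1
    _ = _ := by
        rw [hM]
        ring

end
end

section
/- For all constants a1, a2, b1, b2 > 0 and every ε > 0 there exist Z0 ≥ 1 and K > 0 such that for all real Z1, Z2, R1, R2 ≥ Z0 satisfying b1·Z2 ≤ Z1² ≤ b2·Z2, the set 𝒳 := { (x2,x4,x5) ∈ ℝ³ : |ξ1(x2,x4,x5) − Z1| ≤ a1·Z1/R1 and |ξ2(x2,x4,x5) − Z2| ≤ a2·Z2/R2 } has Lebesgue measure vol(𝒳) ≤ K · (Z1·Z2)^{1/2} · (R1·R2)^{−1} · (Z1·Z2·R1·R2)^ε. -/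
open MeasureTheory

noncomputable section

/-- `ξ_{βαβ,1}` in coordinates `(x2, x4, x5)`. -/
def ξbab1 (x2 x4 x5 : ℝ) : ℝ := x4 ^ 2 + x5 ^ 2 + 1

/-- `ξ_{βαβ,2}`. -/
def ξbab2 (x2 x4 x5 : ℝ) : ℝ :=
  (x4 ^ 2 - x2 * x5) ^ 2 + x2 ^ 2 + 2 * x4 ^ 2 + x5 ^ 2 + 1

lemma setLIntegral_comp_sq_add_le_of_injOn {s : Set ℝ} {m : ℝ} (hs : MeasurableSet s) (hm : 0 < m)
    (hsm : ∀ x ∈ s, m ≤ |x|) (hinj : Set.InjOn (fun x : ℝ => x ^ 2) s) (g : ℝ → ENNReal) (c : ℝ) :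
    ∫⁻ x in s, g (x ^ 2 + c) ≤ ENNReal.ofReal (1 / (2 * m)) * ∫⁻ y, g y := by
  have hderiv : ∀ x ∈ s, HasDerivWithinAt (fun x : ℝ => x ^ 2 + c) (2 * x) s x := fun x _ => by
    simpa using ((hasDerivAt_pow 2 x).add_const c).hasDerivWithinAt
  have himage := lintegral_image_eq_lintegral_abs_deriv_mul hs hderiv
    (fun x hx y hy h => hinj hx hy (add_right_cancel h)) g
  calc ∫⁻ x in s, g (x ^ 2 + c)
      ≤ ∫⁻ x in s, ENNReal.ofReal (1 / (2 * m)) * (ENNReal.ofReal |2 * x| * g (x ^ 2 + c)) := by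
        refine setLIntegral_mono' hs fun x hx => ?_
        rw [← mul_assoc, ← ENNReal.ofReal_mul (by positivity)]
        refine le_mul_of_one_le_left (by positivity) ?_
        rw [ENNReal.one_le_ofReal, abs_mul, abs_two, one_div_mul_eq_div, one_le_div (by positivity)]
        linarith [hsm x hx]
    _ = ENNReal.ofReal (1 / (2 * m)) * ∫⁻ y in (fun x : ℝ => x ^ 2 + c) '' s, g y := by
        rw [himage, lintegral_const_mul' _ _ ENNReal.ofReal_ne_top]
    _ ≤ _ := by gcongr; exact Measure.restrict_le_self

lemma setLIntegral_comp_sq_add_le {m : ℝ} (hm : 0 < m) (g : ℝ → ENNReal) (c : ℝ) :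
    ∫⁻ x in {x : ℝ | m ≤ |x|}, g (x ^ 2 + c) ≤ ENNReal.ofReal (1 / m) * ∫⁻ y, g y := by
  have hset : {x : ℝ | m ≤ |x|} = Set.Ici m ∪ Set.Iic (-m) := by
    ext x
    simp [le_abs, le_neg]
  have hpos := setLIntegral_comp_sq_add_le_of_injOn (s := Set.Ici m) measurableSet_Ici hm
    (fun x hx => le_trans hx (le_abs_self x))
    (fun x hx y hy h => by
      simp only [Set.mem_Ici] at hx hy
      exact (sq_eq_sq₀ (by linarith) (by linarith)).1 h) g c
  have hneg := setLIntegral_comp_sq_add_le_of_injOn (s := Set.Iic (-m)) measurableSet_Iic hm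
    (fun x hx => le_trans (le_neg.1 hx) (neg_le_abs x))
    (fun x hx y hy h => by
      simp only [Set.mem_Iic] at hx hy
      have := (sq_eq_sq₀ (a := -x) (b := -y) (by linarith) (by linarith)).1 (by simpa using h)
      linarith) g c
  calc ∫⁻ x in {x : ℝ | m ≤ |x|}, g (x ^ 2 + c)
      ≤ ENNReal.ofReal (1 / (2 * m)) * (∫⁻ y, g y) + ENNReal.ofReal (1 / (2 * m)) * ∫⁻ y, g y := by
        rw [hset]
        exact (lintegral_union_le _ _ _).trans (add_le_add hpos hneg)
    _ = _ := by
        rw [← add_mul, ← ENNReal.ofReal_add (by positivity) (by positivity)]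
        congr 2
        field_simp
        norm_num

lemma volume_sq_near_and_le_abs_le {m d : ℝ} (hm : 0 < m) (c : ℝ) :
    volume {x : ℝ | |x ^ 2 - c| ≤ d ∧ m ≤ |x|} ≤ ENNReal.ofReal (2 * d / m) := by
  have hmeas : MeasurableSet {x : ℝ | |x ^ 2 - c| ≤ d} := by measurability
  have hm' : MeasurableSet {y : ℝ | |y - c| ≤ d} := by measurability
  have h := setLIntegral_comp_sq_add_le hm ({y : ℝ | |y - c| ≤ d}.indicator 1) 0
  have hball : {y : ℝ | |y - c| ≤ d} = Metric.closedBall c d := by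
    ext y; simp [Real.dist_eq]
  rw [lintegral_indicator_one hm', hball, Real.volume_closedBall,
    ← ENNReal.ofReal_mul (by positivity), ← hball] at h
  refine le_of_eq_of_le ?_ (h.trans (le_of_eq (by congr 1; ring)))
  have : (fun x : ℝ => {y : ℝ | |y - c| ≤ d}.indicator (1 : ℝ → ENNReal) (x ^ 2 + 0)) =
      {x : ℝ | |x ^ 2 - c| ≤ d}.indicator 1 := by
    ext x; simp [Set.indicator]
  rw [this, lintegral_indicator_one hmeas, Measure.restrict_apply hmeas]
  rfl

lemma volume_sq_near_le {d : ℝ} (c : ℝ) :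
    volume {x : ℝ | |x ^ 2 - c| ≤ d} ≤ ENNReal.ofReal (4 * √d) := by
  set p := √(c - d)
  set q := √(c + d)
  have hsub : {x : ℝ | |x ^ 2 - c| ≤ d} ⊆ Set.Icc p q ∪ Set.Icc (-q) (-p) := by
    intro x hx
    obtain ⟨h1, h2⟩ := abs_le.1 (show |x ^ 2 - c| ≤ d from hx)
    have hp : p ≤ |x| := Real.sqrt_le_iff.2 ⟨abs_nonneg x, by rw [sq_abs]; linarith⟩
    have hq : |x| ≤ q := Real.le_sqrt_of_sq_le (by rw [sq_abs]; linarith)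
    rcases abs_cases x with ⟨h, -⟩ | ⟨h, -⟩ <;> rw [h] at hp hq
    · exact Or.inl ⟨hp, hq⟩
    · exact Or.inr ⟨by linarith, by linarith⟩
  have hqp : q - p ≤ 2 * √d := by
    rw [sub_le_iff_le_add]
    refine Real.sqrt_le_iff.2 ⟨by positivity, ?_⟩
    have hp0 : 0 ≤ p := Real.sqrt_nonneg _
    have hd0 : 0 ≤ √d := Real.sqrt_nonneg _
    have hp2 : c - d ≤ p ^ 2 := (Real.sqrt_le_iff.1 le_rfl).2
    have hd2 : d ≤ √d ^ 2 := (Real.sqrt_le_iff.1 le_rfl).2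
    nlinarith [mul_nonneg hp0 hd0]
  calc volume {x : ℝ | |x ^ 2 - c| ≤ d} ≤ volume (Set.Icc p q) + volume (Set.Icc (-q) (-p)) :=
        (measure_mono hsub).trans (measure_union_le _ _)
    _ = ENNReal.ofReal (q - p) + ENNReal.ofReal (q - p) := by
        rw [Real.volume_Icc, Real.volume_Icc, neg_sub_neg]
    _ ≤ ENNReal.ofReal (2 * √d) + ENNReal.ofReal (2 * √d) := by gcongr
    _ = ENNReal.ofReal (4 * √d) := by
        rw [← ENNReal.ofReal_add (by positivity) (by positivity)]
        congr 1
        ring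

lemma volume_sq_near_le_div {c d w : ℝ} (hw : 0 < w) (hd : 0 ≤ d) (hwc : w ^ 2 ≤ |c|) :
    volume {x : ℝ | |x ^ 2 - c| ≤ d} ≤ ENNReal.ofReal (8 * d / w) := by
  rcases le_or_gt (w ^ 2) (2 * d) with h | h
  · refine (volume_sq_near_le c).trans (ENNReal.ofReal_le_ofReal ?_)
    rw [le_div_iff₀ hw]
    have hw2 : w ≤ 2 * √d := by
      refine abs_le_of_sq_le_sq' ?_ (by positivity) |>.2
      rw [mul_pow, Real.sq_sqrt hd]; linarith
    nlinarith [Real.sq_sqrt hd, mul_le_mul_of_nonneg_left hw2 (Real.sqrt_nonneg d)]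
  · have hsub : {x : ℝ | |x ^ 2 - c| ≤ d} ⊆ {x : ℝ | |x ^ 2 - c| ≤ d ∧ w / 2 ≤ |x|} := by
      intro x hx
      refine ⟨hx, ?_⟩
      obtain ⟨h1, h2⟩ := abs_le.1 (show |x ^ 2 - c| ≤ d from hx)
      refine abs_le_of_sq_le_sq' ?_ (abs_nonneg x) |>.2
      rw [sq_abs]
      rcases abs_cases c with ⟨hc, -⟩ | ⟨hc, -⟩ <;> nlinarith [sq_nonneg x]
    refine (measure_mono hsub).trans ((volume_sq_near_and_le_abs_le (by positivity) c).trans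
      (ENNReal.ofReal_le_ofReal ?_))
    rw [show 2 * d / (w / 2) = 4 * d / w by field_simp; ring]
    gcongr
    norm_num

lemma volume_sq_near_le_rpow {c d w θ : ℝ} (hd : 0 < d) (hwc : w ^ 2 ≤ |c|)
    (hθ : 0 < θ) (hθ' : θ < 1 / 2) :
    volume {x : ℝ | |x ^ 2 - c| ≤ d} ≤
      ENNReal.ofReal (8 * d ^ (1 - θ)) * ENNReal.ofReal |w| ^ (2 * θ - 1) := by
  rcases eq_or_ne w 0 with rfl | hw0
  · rw [abs_zero, ENNReal.ofReal_zero, ENNReal.zero_rpow_of_neg (by linarith),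
      ENNReal.mul_top (by simpa using by positivity)]
    exact le_top
  have hw : 0 < |w| := abs_pos.2 hw0
  rw [ENNReal.ofReal_rpow_of_pos hw, ← ENNReal.ofReal_mul (by positivity)]
  rw [← sq_abs] at hwc
  generalize |w| = w at *
  rcases le_or_gt w (√d) with h | h
  · refine (volume_sq_near_le c).trans (ENNReal.ofReal_le_ofReal ?_)
    have h1 : (√d) ^ (2 * θ - 1) ≤ w ^ (2 * θ - 1) :=
      Real.rpow_le_rpow_of_nonpos hw h (by linarith)
    have h2 : √d = d ^ (1 - θ) * (√d) ^ (2 * θ - 1) := by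
      rw [Real.sqrt_eq_rpow, ← Real.rpow_mul hd.le, ← Real.rpow_add hd]
      congr 1; ring
    have h3 := mul_le_mul_of_nonneg_left h1 (Real.rpow_nonneg hd.le (1 - θ))
    rw [← h2] at h3
    nlinarith [Real.sqrt_nonneg d]
  · refine (volume_sq_near_le_div hw hd.le hwc).trans (ENNReal.ofReal_le_ofReal ?_)
    have h1 : d ^ θ ≤ w ^ (2 * θ) := by
      calc d ^ θ = (√d) ^ (2 * θ) := by
            rw [Real.sqrt_eq_rpow, ← Real.rpow_mul hd.le]; congr 1; ring
        _ ≤ w ^ (2 * θ) := Real.rpow_le_rpow (Real.sqrt_nonneg d) h.le (by linarith)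
    have h2 : d = d ^ (1 - θ) * d ^ θ := by
      rw [← Real.rpow_add hd]; simp
    rw [Real.rpow_sub hw, Real.rpow_one, ← mul_div_assoc]
    refine div_le_div_of_nonneg_right ?_ hw.le
    rw [mul_assoc]
    conv_lhs => rw [h2]
    gcongr

lemma setLIntegral_rpow_abs_le {B θ : ℝ} (hB : 0 < B) (hθ : 0 < θ) :
    ∫⁻ y in {y : ℝ | |y| ≤ B}, ENNReal.ofReal |y| ^ (2 * θ - 1) ≤
      ENNReal.ofReal (B ^ (2 * θ) / θ) := by
  have hhalf : ∫⁻ y in Set.Ioc 0 B, ENNReal.ofReal |y| ^ (2 * θ - 1) =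
      ENNReal.ofReal (B ^ (2 * θ) / (2 * θ)) := by
    have hint : IntegrableOn (fun y : ℝ => y ^ (2 * θ - 1)) (Set.Ioc 0 B) :=
      (intervalIntegrable_iff_integrableOn_Ioc_of_le hB.le).1
        (intervalIntegral.intervalIntegrable_rpow' (by linarith))
    have hval : ∫ y in Set.Ioc 0 B, y ^ (2 * θ - 1) = B ^ (2 * θ) / (2 * θ) := by
      rw [← intervalIntegral.integral_of_le hB.le, integral_rpow (Or.inl (by linarith)),
        sub_add_cancel, Real.zero_rpow (by positivity), sub_zero]
    rw [← hval, ofReal_integral_eq_lintegral_ofReal hint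
      ((ae_restrict_iff' measurableSet_Ioc).2 (Filter.Eventually.of_forall
        fun y hy => Real.rpow_nonneg hy.1.le _))]
    refine setLIntegral_congr_fun measurableSet_Ioc fun y hy => ?_
    rw [abs_of_pos hy.1, ENNReal.ofReal_rpow_of_pos hy.1]
  have hneg : ∫⁻ y in Set.Ico (-B) 0, ENNReal.ofReal |y| ^ (2 * θ - 1) =
      ENNReal.ofReal (B ^ (2 * θ) / (2 * θ)) := by
    rw [← hhalf, ← (Measure.measurePreserving_neg (volume : Measure ℝ)).setLIntegral_comp_preimage
      measurableSet_Ioc (by fun_prop)]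
    simp
  have hsub : {y : ℝ | |y| ≤ B} ⊆ (Set.Ioc 0 B ∪ Set.Ico (-B) 0) ∪ {0} := by
    intro y hy
    obtain ⟨h1, h2⟩ := abs_le.1 (show |y| ≤ B from hy)
    rcases lt_trichotomy y 0 with h | h | h
    · exact Or.inl (Or.inr ⟨h1, h⟩)
    · exact Or.inr h
    · exact Or.inl (Or.inl ⟨h, h2⟩)
  calc ∫⁻ y in {y : ℝ | |y| ≤ B}, ENNReal.ofReal |y| ^ (2 * θ - 1)
      ≤ (∫⁻ y in Set.Ioc 0 B, ENNReal.ofReal |y| ^ (2 * θ - 1)) +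
        (∫⁻ y in Set.Ico (-B) 0, ENNReal.ofReal |y| ^ (2 * θ - 1)) + 0 := by
        refine (lintegral_mono_set hsub).trans ((lintegral_union_le _ _ _).trans ?_)
        refine add_le_add (lintegral_union_le _ _ _) ?_
        simp
    _ = ENNReal.ofReal (B ^ (2 * θ) / θ) := by
        rw [hhalf, hneg, add_zero, ← ENNReal.ofReal_add (by positivity) (by positivity)]
        congr 1
        field_simp
        norm_num

lemma setLIntegral_rpow_abs_sub_le {B θ : ℝ} (hB : 0 < B) (hθ : 0 < θ) (hθ' : θ < 1 / 2) (a : ℝ) :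
    ∫⁻ x in {x : ℝ | |x| ≤ B}, ENNReal.ofReal |x - a| ^ (2 * θ - 1) ≤
      ENNReal.ofReal ((1 / θ + 2) * B ^ (2 * θ)) := by
  have hmeas : MeasurableSet {y : ℝ | |y| ≤ B} := by measurability
  set f : ℝ → ENNReal := {y : ℝ | |y| ≤ B}.indicator fun y => ENNReal.ofReal |y| ^ (2 * θ - 1)
    with hf
  have hfm : Measurable f := Measurable.indicator (by fun_prop) hmeas
  have hpt : ∀ y, ENNReal.ofReal |y| ^ (2 * θ - 1) ≤ f y + ENNReal.ofReal (B ^ (2 * θ - 1)) := by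
    intro y
    rcases le_or_gt |y| B with h | h
    · rw [hf, Set.indicator_of_mem (show y ∈ {y : ℝ | |y| ≤ B} from h)]
      exact le_self_add
    · rw [ENNReal.ofReal_rpow_of_pos (hB.trans h)]
      exact le_add_left (ENNReal.ofReal_le_ofReal
        (Real.rpow_le_rpow_of_nonpos hB h.le (by linarith)))
  have hvol : volume {y : ℝ | |y| ≤ B} = ENNReal.ofReal (2 * B) := by
    rw [show {y : ℝ | |y| ≤ B} = Metric.closedBall 0 B by ext y; simp, Real.volume_closedBall]
  calc ∫⁻ x in {x : ℝ | |x| ≤ B}, ENNReal.ofReal |x - a| ^ (2 * θ - 1)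
      ≤ ∫⁻ x in {x : ℝ | |x| ≤ B}, (f (x - a) + ENNReal.ofReal (B ^ (2 * θ - 1))) :=
        lintegral_mono fun x => hpt (x - a)
    _ ≤ (∫⁻ x, f x) + ENNReal.ofReal (B ^ (2 * θ - 1)) * ENNReal.ofReal (2 * B) := by
        rw [lintegral_add_right _ measurable_const, setLIntegral_const, hvol,
          ← lintegral_sub_right_eq_self f a]
        gcongr
        exact Measure.restrict_le_self
    _ ≤ ENNReal.ofReal (B ^ (2 * θ) / θ) + ENNReal.ofReal (2 * B ^ (2 * θ)) := by
        rw [hf, lintegral_indicator hmeas, ← ENNReal.ofReal_mul (by positivity)]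
        refine add_le_add (setLIntegral_rpow_abs_le hB hθ) (ENNReal.ofReal_le_ofReal (le_of_eq ?_))
        rw [Real.rpow_sub_one hB.ne']
        field_simp
    _ = _ := by
        rw [← ENNReal.ofReal_add (by positivity) (by positivity)]
        congr 1
        ring

lemma setLIntegral_rpow_abs_abs_sub_le {B θ : ℝ} (hB : 0 < B) (hθ : 0 < θ) (hθ' : θ < 1 / 2)
    (a : ℝ) :
    ∫⁻ x in {x : ℝ | |x| ≤ B}, ENNReal.ofReal |(|x| - a)| ^ (2 * θ - 1) ≤
      ENNReal.ofReal (2 * (1 / θ + 2) * B ^ (2 * θ)) := by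
  calc ∫⁻ x in {x : ℝ | |x| ≤ B}, ENNReal.ofReal |(|x| - a)| ^ (2 * θ - 1)
      ≤ ∫⁻ x in {x : ℝ | |x| ≤ B}, (ENNReal.ofReal |x - a| ^ (2 * θ - 1) +
          ENNReal.ofReal |x - -a| ^ (2 * θ - 1)) := by
        refine lintegral_mono fun x => ?_
        simp only
        rcases abs_cases x with ⟨h, -⟩ | ⟨h, -⟩ <;> rw [h]
        · exact le_self_add
        · rw [show |-x - a| = |x - -a| by rw [← abs_neg]; congr 1; ring]
          exact le_add_self
    _ ≤ ENNReal.ofReal ((1 / θ + 2) * B ^ (2 * θ)) +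
          ENNReal.ofReal ((1 / θ + 2) * B ^ (2 * θ)) := by
        rw [lintegral_add_left (by fun_prop)]
        exact add_le_add (setLIntegral_rpow_abs_sub_le hB hθ hθ' a)
          (setLIntegral_rpow_abs_sub_le hB hθ hθ' (-a))
    _ = _ := by
        rw [← ENNReal.ofReal_add (by positivity) (by positivity)]
        congr 1
        ring

lemma volume_ξbab2_near_eq (x4 x5 Z δ : ℝ) :
    volume {x2 : ℝ | |ξbab2 x2 x4 x5 - Z| ≤ δ} =
      volume {u : ℝ | |u ^ 2 - ((x5 ^ 2 + 1) * Z - (x4 ^ 2 + (x5 ^ 2 + 1)) ^ 2) /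
        (x5 ^ 2 + 1) ^ 2| ≤ δ / (x5 ^ 2 + 1)} := by
  have ht : 0 < x5 ^ 2 + 1 := by positivity
  rw [← measure_preimage_add_right volume (-(x4 ^ 2 * x5 / (x5 ^ 2 + 1)))
    {u : ℝ | |u ^ 2 - _| ≤ _}]
  congr 1
  ext x2
  simp only [Set.mem_ofPred_eq, Set.mem_preimage]
  rw [le_div_iff₀ ht]
  conv_rhs => rw [← abs_of_pos ht, ← abs_mul, abs_of_pos ht]
  congr! 2
  unfold ξbab2
  field_simp
  ring

lemma volume_ξbab2_near_le_rpow {x4 x5 Z δ θ : ℝ} (hZ : 0 < Z) (hδ : 0 < δ)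
    (hθ : 0 < θ) (hθ' : θ < 1 / 2) :
    volume {x2 : ℝ | |ξbab2 x2 x4 x5 - Z| ≤ δ} ≤
      ENNReal.ofReal (8 * δ ^ (1 - θ) * Z ^ (θ - 1 / 2)) *
        ENNReal.ofReal |(|x5| - √((x4 ^ 2 + (x5 ^ 2 + 1)) ^ 2 / Z - 1))| ^ (2 * θ - 1) := by
  rw [volume_ξbab2_near_eq]
  have ht1 : 1 ≤ x5 ^ 2 + 1 := by nlinarith
  generalize hs : x4 ^ 2 + (x5 ^ 2 + 1) = s
  generalize htdef : x5 ^ 2 + 1 = t at *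
  have ht : 0 < t := by linarith
  set a := √(s ^ 2 / Z - 1) with ha
  have hroot : (|x5| - a) ^ 2 ≤ |x5 ^ 2 - (s ^ 2 / Z - 1)| := by
    have ha0 : 0 ≤ a := Real.sqrt_nonneg _
    rw [← sq_abs x5]
    rcases le_or_gt 0 (s ^ 2 / Z - 1) with h | h
    · rw [← Real.sq_sqrt h, ← ha, sq_sub_sq, abs_mul, ← sq_abs (|x5| - a), sq, mul_comm |(|x5| + a)|]
      refine mul_le_mul_of_nonneg_left ?_ (abs_nonneg _)
      rw [abs_of_nonneg (by positivity : 0 ≤ |x5| + a)]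
      exact abs_le.2 ⟨by linarith [abs_nonneg x5], by linarith⟩
    · rw [ha, Real.sqrt_eq_zero_of_nonpos h.le, sub_zero]
      exact le_trans (by linarith) (le_abs_self _)
  have hw : (√Z / t * (|x5| - a)) ^ 2 ≤ |(t * Z - s ^ 2) / t ^ 2| := by
    have : (t * Z - s ^ 2) / t ^ 2 = Z / t ^ 2 * (x5 ^ 2 - (s ^ 2 / Z - 1)) := by
      rw [← htdef]
      field_simp
      ring
    rw [this, abs_mul, abs_of_pos (by positivity : 0 < Z / t ^ 2), mul_pow, div_pow,
      Real.sq_sqrt hZ.le]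
    gcongr
  refine (volume_sq_near_le_rpow (div_pos hδ ht) hw hθ hθ').trans ?_
  rw [abs_mul, abs_of_pos (by positivity : 0 < √Z / t), ENNReal.ofReal_mul (p := √Z / t) (by positivity),
    ENNReal.mul_rpow_of_ne_top ENNReal.ofReal_ne_top ENNReal.ofReal_ne_top,
    ENNReal.ofReal_rpow_of_pos (by positivity), ← mul_assoc, ← ENNReal.ofReal_mul (by positivity)]
  gcongr ENNReal.ofReal ?_ * _
  have hZpow : √Z ^ (2 * θ - 1) = Z ^ (θ - 1 / 2) := by
    rw [Real.sqrt_eq_rpow, ← Real.rpow_mul hZ.le]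
    congr 1
    ring
  rw [Real.div_rpow hδ.le ht.le, Real.div_rpow (Real.sqrt_nonneg _) ht.le, hZpow]
  have htpow : t ^ (1 - θ) * t ^ (2 * θ - 1) = t ^ θ := by
    rw [← Real.rpow_add ht]
    congr 1
    ring
  calc 8 * (δ ^ (1 - θ) / t ^ (1 - θ)) * (Z ^ (θ - 1 / 2) / t ^ (2 * θ - 1))
      = 8 * δ ^ (1 - θ) * Z ^ (θ - 1 / 2) / t ^ θ := by rw [← htpow]; field_simp
    _ ≤ 8 * δ ^ (1 - θ) * Z ^ (θ - 1 / 2) :=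
        div_le_self (by positivity) (Real.one_le_rpow ht1 hθ.le)

lemma volume_ξbab2_near_le {x4 x5 Z δ : ℝ} (hZ : 0 < Z) (hδ : 0 < δ)
    (hx : (x4 ^ 2 + (x5 ^ 2 + 1)) ^ 2 ≤ (x5 ^ 2 + 1) * Z / 2) :
    volume {x2 : ℝ | |ξbab2 x2 x4 x5 - Z| ≤ δ} ≤
      ENNReal.ofReal (16 * δ / √((x5 ^ 2 + 1) * Z)) := by
  rw [volume_ξbab2_near_eq]
  have ht : 0 < x5 ^ 2 + 1 := by positivity
  generalize x4 ^ 2 + (x5 ^ 2 + 1) = s at *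
  generalize x5 ^ 2 + 1 = t at *
  have hw : (√(t * Z) / (2 * t)) ^ 2 ≤ |(t * Z - s ^ 2) / t ^ 2| := by
    refine le_trans ?_ (le_abs_self _)
    rw [div_pow, Real.sq_sqrt (by positivity), mul_pow, div_le_div_iff₀ (by positivity)
      (by positivity)]
    nlinarith [mul_pos ht hZ, mul_pos ht ht]
  refine (volume_sq_near_le_div (by positivity) (by positivity) hw).trans (le_of_eq ?_)
  congr 1
  field_simp
  ring

lemma lintegral_comp_sq_add_sq_le {m : ℝ} (hm : 0 < m) {H : ℝ × ℝ → ENNReal} (hH : Measurable H) :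
    ∫⁻ p in {p : ℝ × ℝ | m ≤ |p.1|}, H (p.1 ^ 2 + (p.2 ^ 2 + 1), p.2) ≤
      ENNReal.ofReal (1 / m) * ∫⁻ s, ∫⁻ x, H (s, x) := by
  have hmeas : MeasurableSet {x : ℝ | m ≤ |x|} := by measurability
  have hset : {p : ℝ × ℝ | m ≤ |p.1|} = {x : ℝ | m ≤ |x|} ×ˢ Set.univ := by
    ext p
    simp
  rw [hset, Measure.volume_eq_prod, ← Measure.prod_restrict, Measure.restrict_univ,
    lintegral_prod_symm _ (by fun_prop)]
  calc ∫⁻ x, ∫⁻ y in {x : ℝ | m ≤ |x|}, H (y ^ 2 + (x ^ 2 + 1), x)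
      ≤ ∫⁻ x, ENNReal.ofReal (1 / m) * ∫⁻ s, H (s, x) :=
        lintegral_mono fun x => setLIntegral_comp_sq_add_le hm (fun s => H (s, x)) (x ^ 2 + 1)
    _ = ENNReal.ofReal (1 / m) * ∫⁻ s, ∫⁻ x, H (s, x) := by
        rw [lintegral_const_mul' _ _ ENNReal.ofReal_ne_top, lintegral_lintegral_swap]
        fun_prop

lemma volume_annulus_near_axis_le {m η Z : ℝ} (hm : 0 < m) :
    volume {p : ℝ × ℝ | |p.1 ^ 2 + (p.2 ^ 2 + 1) - Z| ≤ η ∧ |p.1| ≤ m ∧ m ≤ |p.2|} ≤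
      ENNReal.ofReal (4 * η) := by
  have hmeas : MeasurableSet
      {p : ℝ × ℝ | |p.1 ^ 2 + (p.2 ^ 2 + 1) - Z| ≤ η ∧ |p.1| ≤ m ∧ m ≤ |p.2|} := by
    measurability
  have hball : MeasurableSet {x : ℝ | |x| ≤ m} := by measurability
  rw [Measure.volume_eq_prod, Measure.prod_apply hmeas]
  calc _ ≤ ∫⁻ x, {x : ℝ | |x| ≤ m}.indicator (fun _ => ENNReal.ofReal (2 * η / m)) x := by
        refine lintegral_mono fun x => ?_
        by_cases hx : |x| ≤ m
        · rw [Set.indicator_of_mem (show x ∈ {x : ℝ | |x| ≤ m} from hx)]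
          refine (measure_mono fun y hy => ?_).trans
            (volume_sq_near_and_le_abs_le hm (Z - 1 - x ^ 2))
          refine ⟨?_, hy.2.2⟩
          have := hy.1
          rwa [show x ^ 2 + (y ^ 2 + 1) - Z = y ^ 2 - (Z - 1 - x ^ 2) by ring] at this
        · rw [Set.indicator_of_notMem (show x ∉ {x : ℝ | |x| ≤ m} from hx)]
          refine le_of_eq (measure_mono_null (t := ∅) (fun y hy => hx hy.2.1) measure_empty)
    _ = ENNReal.ofReal (4 * η) := by
        rw [lintegral_indicator hball, setLIntegral_const,
          show {y : ℝ | |y| ≤ m} = Metric.closedBall 0 m by ext y; simp, Real.volume_closedBall,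
          ← ENNReal.ofReal_mul' (by positivity)]
        congr 1
        field_simp
        ring

lemma lintegral_tube_majorant_le {Z1 Z2 η B k θ : ℝ} (hB : 0 < B) (hk : 0 ≤ k)
    (hθ : 0 < θ) (hθ' : θ < 1 / 2) :
    ∫⁻ s, ∫⁻ x, ({s : ℝ | |s - Z1| ≤ η} ×ˢ {x : ℝ | |x| ≤ B}).indicator (fun q : ℝ × ℝ =>
        ENNReal.ofReal k * ENNReal.ofReal |(|q.2| - √(q.1 ^ 2 / Z2 - 1))| ^ (2 * θ - 1)) (s, x) ≤
      ENNReal.ofReal (2 * η * (k * (2 * (1 / θ + 2) * B ^ (2 * θ)))) := by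
  have hball : MeasurableSet {s : ℝ | |s - Z1| ≤ η} := by measurability
  have hball' : MeasurableSet {x : ℝ | |x| ≤ B} := by measurability
  calc _ ≤ ∫⁻ s, {s : ℝ | |s - Z1| ≤ η}.indicator (fun _ =>
          ENNReal.ofReal (k * (2 * (1 / θ + 2) * B ^ (2 * θ)))) s := by
        refine lintegral_mono fun s => ?_
        by_cases hs : s ∈ {s : ℝ | |s - Z1| ≤ η}
        · rw [Set.indicator_of_mem hs, ENNReal.ofReal_mul hk]
          refine le_of_eq_of_le ?_ (mul_le_mul_right
            (setLIntegral_rpow_abs_abs_sub_le hB hθ hθ' (√(s ^ 2 / Z2 - 1))) _)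
          rw [← lintegral_const_mul' _ _ ENNReal.ofReal_ne_top, ← lintegral_indicator hball']
          refine lintegral_congr fun x => ?_
          by_cases hx : x ∈ {x : ℝ | |x| ≤ B}
          · rw [Set.indicator_of_mem hx, Set.indicator_of_mem (Set.mk_mem_prod hs hx)]
          · rw [Set.indicator_of_notMem hx, Set.indicator_of_notMem fun h => hx h.2]
        · rw [Set.indicator_of_notMem hs]
          refine le_of_eq (lintegral_eq_zero_of_ae_eq_zero
            (Filter.Eventually.of_forall fun x => ?_))
          exact Set.indicator_of_notMem (fun h => hs h.1) _
    _ = _ := by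
        rw [lintegral_indicator hball, setLIntegral_const,
          show {s : ℝ | |s - Z1| ≤ η} = Metric.closedBall Z1 η by ext y; simp [Real.dist_eq],
          Real.volume_closedBall, ← ENNReal.ofReal_mul (by positivity)]
        congr 1
        ring

/-- The tube volume as the integral over `(x4, x5)` of the lengths of its `x2`-sections, bounded by
splitting the plane according to whether `|x4|` is at least `√Z1 / 2`. -/
lemma volume_tube_le {Z1 Z2 η δ θ : ℝ} (hZ1 : 4 ≤ Z1) (hZ2 : 0 < Z2) (hη : 0 ≤ η)
    (hηZ : η ≤ Z1 / 4) (hδ : 0 < δ) (hZ : 32 * Z1 ≤ Z2) (hθ : 0 < θ) (hθ' : θ < 1 / 2) :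
    volume {x : ℝ × ℝ × ℝ | |ξbab1 x.1 x.2.1 x.2.2 - Z1| ≤ η ∧ |ξbab2 x.1 x.2.1 x.2.2 - Z2| ≤ δ} ≤
      ENNReal.ofReal (1 / (√Z1 / 2) * (2 * η * (8 * δ ^ (1 - θ) * Z2 ^ (θ - 1 / 2) *
        (2 * (1 / θ + 2) * (2 * √Z1) ^ (2 * θ)))) + 32 * δ / √(Z1 * Z2) * (4 * η)) := by
  have hZ1' : 0 < Z1 := by linarith
  set m := √Z1 / 2 with hm
  have hm0 : 0 < m := by positivity
  have hm2 : m ^ 2 = Z1 / 4 := by rw [hm, div_pow, Real.sq_sqrt hZ1'.le]; norm_num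
  set k := 8 * δ ^ (1 - θ) * Z2 ^ (θ - 1 / 2) with hk
  set H : ℝ × ℝ → ENNReal :=
    ({s : ℝ | |s - Z1| ≤ η} ×ˢ {x : ℝ | |x| ≤ 2 * √Z1}).indicator (fun q : ℝ × ℝ =>
        ENNReal.ofReal k * ENNReal.ofReal |(|q.2| - √(q.1 ^ 2 / Z2 - 1))| ^ (2 * θ - 1)) with hHdef
  have hH : Measurable H := by
    refine Measurable.indicator (by fun_prop) (MeasurableSet.prod ?_ ?_) <;> measurability
  set A : Set (ℝ × ℝ) := {p | m ≤ |p.1|} with hA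
  set E : Set (ℝ × ℝ) := {p | |p.1 ^ 2 + (p.2 ^ 2 + 1) - Z1| ≤ η ∧ |p.1| ≤ m ∧ m ≤ |p.2|} with hE
  have hAm : MeasurableSet A := measurableSet_le (by fun_prop) (by fun_prop)
  have hEm : MeasurableSet E := by measurability
  set G : ℝ × ℝ → ENNReal := fun p => H (p.1 ^ 2 + (p.2 ^ 2 + 1), p.2) with hG
  have hGm : Measurable G := by fun_prop
  have hX : MeasurableSet {x : ℝ × ℝ × ℝ |
      |ξbab1 x.1 x.2.1 x.2.2 - Z1| ≤ η ∧ |ξbab2 x.1 x.2.1 x.2.2 - Z2| ≤ δ} := by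
    unfold ξbab1 ξbab2
    measurability
  rw [Measure.volume_eq_prod, Measure.prod_apply_symm hX]
  calc _ ≤ ∫⁻ p, (A.indicator G p + E.indicator (fun _ =>
          ENNReal.ofReal (32 * δ / √(Z1 * Z2))) p) := by
        refine lintegral_mono fun ⟨x4, x5⟩ => ?_
        by_cases h1 : |x4 ^ 2 + (x5 ^ 2 + 1) - Z1| ≤ η
        swap
        · refine (le_of_eq (measure_mono_null (t := ∅) (fun y hy => h1 ?_) measure_empty)).trans
            zero_le
          have := hy.1
          rwa [ξbab1, add_assoc] at this
        obtain ⟨hlo, hhi⟩ := abs_le.1 h1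
        refine (measure_mono (t := {x2 : ℝ | |ξbab2 x2 x4 x5 - Z2| ≤ δ}) fun y hy => hy.2).trans ?_
        by_cases h4 : m ≤ |x4|
        · have hx5 : |x5| ≤ 2 * √Z1 := by
            refine abs_le_of_sq_le_sq' ?_ (by positivity) |>.2
            rw [sq_abs, mul_pow, Real.sq_sqrt hZ1'.le]
            nlinarith [sq_nonneg x4]
          refine le_add_right ?_
          rw [Set.indicator_of_mem (show (x4, x5) ∈ A from h4)]
          refine le_of_le_of_eq ?_ (Set.indicator_of_mem (Set.mk_mem_prod
            (show x4 ^ 2 + (x5 ^ 2 + 1) ∈ {s : ℝ | |s - Z1| ≤ η} from h1)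
            (show x5 ∈ {x : ℝ | |x| ≤ 2 * √Z1} from hx5)) _).symm
          exact volume_ξbab2_near_le_rpow hZ2 hδ hθ hθ'
        · have hx4 : x4 ^ 2 ≤ Z1 / 4 := by
            rw [← hm2, ← sq_abs]
            exact pow_le_pow_left₀ (abs_nonneg _) (not_le.1 h4).le 2
          have hx5 : Z1 / 4 ≤ x5 ^ 2 := by linarith
          have hx5' : m ≤ |x5| := by
            refine abs_le_of_sq_le_sq' ?_ (abs_nonneg _) |>.2
            rwa [hm2, sq_abs]
          refine le_add_left ?_
          rw [Set.indicator_of_mem (show (x4, x5) ∈ E from ⟨h1, (not_le.1 h4).le, hx5'⟩)]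
          refine (volume_ξbab2_near_le hZ2 hδ ?_).trans (ENNReal.ofReal_le_ofReal ?_)
          · have hs : x4 ^ 2 + (x5 ^ 2 + 1) ≤ 2 * Z1 := by linarith
            have hs0 : 0 ≤ x4 ^ 2 + (x5 ^ 2 + 1) := by positivity
            nlinarith [mul_le_mul hs hs hs0 (by positivity)]
          · have hroot : √(Z1 * Z2) / 2 ≤ √((x5 ^ 2 + 1) * Z2) := by
              refine Real.le_sqrt_of_sq_le ?_
              rw [div_pow, Real.sq_sqrt (by positivity)]
              nlinarith
            calc 16 * δ / √((x5 ^ 2 + 1) * Z2) ≤ 16 * δ / (√(Z1 * Z2) / 2) := by gcongr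
              _ = 32 * δ / √(Z1 * Z2) := by field_simp; norm_num
    _ ≤ ENNReal.ofReal (1 / m * (2 * η * (k * (2 * (1 / θ + 2) * (2 * √Z1) ^ (2 * θ))))) +
          ENNReal.ofReal (32 * δ / √(Z1 * Z2) * (4 * η)) := by
        rw [lintegral_add_left (hGm.indicator hAm), lintegral_indicator hAm,
          lintegral_indicator hEm, setLIntegral_const, ENNReal.ofReal_mul (by positivity),
          ENNReal.ofReal_mul (p := 32 * δ / √(Z1 * Z2)) (by positivity)]
        exact add_le_add ((lintegral_comp_sq_add_sq_le hm0 hH).trans (mul_le_mul_right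
          (lintegral_tube_majorant_le (by positivity) (by positivity) hθ hθ') _))
          (mul_le_mul_right (volume_annulus_near_axis_le hm0) _)
    _ = _ := by rw [← ENNReal.ofReal_add (by positivity) (by positivity)]

lemma rpow_le_rpow_mul_four {Z1 Z2 R1 R2 θ ε : ℝ} (hZ1 : 1 ≤ Z1) (hZ2 : 1 ≤ Z2) (hR1 : 1 ≤ R1)
    (hR2 : 1 ≤ R2) (hθ : 0 ≤ θ) (hθε : θ ≤ ε) :
    Z1 ^ θ * R2 ^ θ ≤ (Z1 * Z2 * R1 * R2) ^ ε := by
  have hZ : 1 ≤ Z1 * R2 := one_le_mul_of_one_le_of_one_le hZ1 hR2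
  have hle : Z1 * R2 ≤ Z1 * Z2 * R1 * R2 := by
    calc Z1 * R2 ≤ Z1 * R2 * (Z2 * R1) :=
          le_mul_of_one_le_right (by positivity) (one_le_mul_of_one_le_of_one_le hZ2 hR1)
      _ = Z1 * Z2 * R1 * R2 := by ring
  rw [← Real.mul_rpow (by positivity) (by positivity)]
  exact (Real.rpow_le_rpow_of_exponent_le hZ hθε).trans
    (Real.rpow_le_rpow (by positivity) hle (hθ.trans hθε))

lemma tube_bound_eq {a1 a2 Z1 Z2 R1 R2 θ : ℝ} (ha2 : 0 < a2) (hZ1 : 0 < Z1)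
    (hZ2 : 0 < Z2) (hR1 : 0 < R1) (hR2 : 0 < R2) :
    1 / (√Z1 / 2) * (2 * (a1 * Z1 / R1) * (8 * (a2 * Z2 / R2) ^ (1 - θ) * Z2 ^ (θ - 1 / 2) *
        (2 * (1 / θ + 2) * (2 * √Z1) ^ (2 * θ)))) +
      32 * (a2 * Z2 / R2) / √(Z1 * Z2) * (4 * (a1 * Z1 / R1)) =
    64 * a1 * a2 ^ (1 - θ) * (1 / θ + 2) * 2 ^ (2 * θ) * (√(Z1 * Z2) / (R1 * R2)) *
        (Z1 ^ θ * R2 ^ θ) +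
      128 * a1 * a2 * (√(Z1 * Z2) / (R1 * R2)) := by
  have hZ2pow : Z2 ^ (1 - θ) * Z2 ^ (θ - 1 / 2) = √Z2 := by
    rw [← Real.rpow_add hZ2, Real.sqrt_eq_rpow]
    congr 1
    ring
  have hR2pow : R2 ^ (1 - θ) * R2 ^ θ = R2 := by
    rw [← Real.rpow_add hR2, sub_add_cancel, Real.rpow_one]
  have hZ1pow : √Z1 ^ (2 * θ) = Z1 ^ θ := by
    rw [Real.sqrt_eq_rpow, ← Real.rpow_mul hZ1.le]
    congr 1
    ring
  have hZ1sq : √Z1 * √Z1 = Z1 := Real.mul_self_sqrt hZ1.le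
  have hZ2sq : √Z2 * √Z2 = Z2 := Real.mul_self_sqrt hZ2.le
  have hsZ1 : √Z1 ≠ 0 := by positivity
  have hsZ2 : √Z2 ≠ 0 := by positivity
  rw [Real.mul_rpow two_pos.le (Real.sqrt_nonneg _), hZ1pow, Real.div_rpow (by positivity) hR2.le,
    Real.mul_rpow ha2.le hZ2.le, Real.sqrt_mul hZ1.le]
  congr 1
  · calc _ = 64 * a1 * a2 ^ (1 - θ) * (1 / θ + 2) * 2 ^ (2 * θ) * (Z1 / √Z1) * Z1 ^ θ / R1 *
          (Z2 ^ (1 - θ) * Z2 ^ (θ - 1 / 2)) / R2 ^ (1 - θ) := by field_simp; ring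
      _ = 64 * a1 * a2 ^ (1 - θ) * (1 / θ + 2) * 2 ^ (2 * θ) * √Z1 * Z1 ^ θ / R1 * √Z2 *
          (R2 ^ θ / (R2 ^ (1 - θ) * R2 ^ θ)) := by
        rw [hZ2pow, Real.div_sqrt]
        field_simp
      _ = _ := by
        rw [hR2pow]
        field_simp
  · calc _ = 128 * a1 * a2 * (Z1 / √Z1) * (Z2 / √Z2) / (R1 * R2) := by field_simp; ring
      _ = _ := by
        rw [Real.div_sqrt, Real.div_sqrt]
        ring

/-- the tube-volume bound for the Weyl element `βαβ`. -/
theorem tube_volume_bab (a1 a2 b1 b2 ε : ℝ)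
    (ha1 : 0 < a1) (ha2 : 0 < a2) (hb1 : 0 < b1) (hb2 : 0 < b2) (hε : 0 < ε) :
    ∃ Z0 ≥ (1:ℝ), ∃ K > (0:ℝ), ∀ Z1 Z2 R1 R2 : ℝ,
      Z0 ≤ Z1 → Z0 ≤ Z2 → Z0 ≤ R1 → Z0 ≤ R2 →
      b1 * Z2 ≤ Z1 ^ 2 → Z1 ^ 2 ≤ b2 * Z2 →
      volume {x : ℝ × ℝ × ℝ |
          |ξbab1 x.1 x.2.1 x.2.2 - Z1| ≤ a1 * Z1 / R1 ∧
          |ξbab2 x.1 x.2.1 x.2.2 - Z2| ≤ a2 * Z2 / R2} ≤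
        ENNReal.ofReal
          (K * Real.sqrt (Z1 * Z2) / (R1 * R2) * (Z1 * Z2 * R1 * R2) ^ ε) := by
  set θ := min ε (1 / 4) with hθdef
  have hθ : 0 < θ := lt_min hε (by norm_num)
  have hθ' : θ < 1 / 2 := (min_le_right _ _).trans_lt (by norm_num)
  set K1 := 64 * a1 * a2 ^ (1 - θ) * (1 / θ + 2) * 2 ^ (2 * θ) with hK1
  have hK1pos : 0 < K1 := by positivity
  refine ⟨4 + 4 * a1 + 32 * b2, by linarith, K1 + 128 * a1 * a2, by positivity, ?_⟩
  intro Z1 Z2 R1 R2 hZ1 hZ2 hR1 hR2 _ hZb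
  have hZ1' : 4 ≤ Z1 := by linarith
  have hZ2' : 1 ≤ Z2 := by linarith
  have hR1' : 1 ≤ R1 := by linarith
  have hR2' : 1 ≤ R2 := by linarith
  have hηZ : a1 * Z1 / R1 ≤ Z1 / 4 := by
    rw [div_le_div_iff₀ (by linarith) (by norm_num)]
    nlinarith
  have hZ : 32 * Z1 ≤ Z2 := by
    have : 32 * b2 * Z1 ≤ Z1 ^ 2 := by nlinarith
    nlinarith
  refine (volume_tube_le hZ1' (by linarith) (by positivity) hηZ (by positivity) hZ hθ hθ').trans
    (ENNReal.ofReal_le_ofReal ?_)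
  rw [tube_bound_eq ha2 (by linarith) (by linarith) (by linarith) (by linarith), ← hK1]
  have hpow := rpow_le_rpow_mul_four (by linarith) hZ2' hR1' hR2' hθ.le (min_le_left ε (1 / 4))
    (Z1 := Z1)
  have hpow1 : 1 ≤ (Z1 * Z2 * R1 * R2) ^ ε :=
    (one_le_mul_of_one_le_of_one_le (Real.one_le_rpow (by linarith) hθ.le)
      (Real.one_le_rpow hR2' hθ.le)).trans hpow
  calc K1 * (√(Z1 * Z2) / (R1 * R2)) * (Z1 ^ θ * R2 ^ θ) +
        128 * a1 * a2 * (√(Z1 * Z2) / (R1 * R2))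
      ≤ K1 * (√(Z1 * Z2) / (R1 * R2)) * (Z1 * Z2 * R1 * R2) ^ ε +
        128 * a1 * a2 * (√(Z1 * Z2) / (R1 * R2)) * (Z1 * Z2 * R1 * R2) ^ ε := by
        refine add_le_add (mul_le_mul_of_nonneg_left hpow (by positivity))
          (le_mul_of_one_le_right (by positivity) hpow1)
    _ = _ := by ring

end
end

section
/- For all constants a1, a2 > 0 and every ε > 0 there exist Z0 ≥ 1 and K > 0 such that for all real Z1, Z2, R1, R2 ≥ Z0, the set 𝒳 := { (x1,x2,x4,x5) ∈ ℝ⁴ : |ξ1(x1,x2,x4,x5) − Z1| ≤ a1·Z1/R1 and |ξ2(x1,x2,x4,x5) − Z2| ≤ a2·Z2/R2 } has Lebesgue measure vol(𝒳) ≤ K · (Z1·Z2)^{1/2} · (R1·R2)^{−1} · (Z1·Z2·R1·R2)^ε. -/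
open MeasureTheory

noncomputable section

/-- `ξ_{w0,1}` in coordinates `(x1, x2, x4, x5)`. -/
def ξw1 (x1 x2 x4 x5 : ℝ) : ℝ :=
  (x4 ^ 2 + x1 * x4 * x5 - x2 * x5) ^ 2 + (x1 * x4 - x2) ^ 2 + 2 * x4 ^ 2 + x5 ^ 2 + 1

/-- `ξ_{w0,2}`. -/
def ξw2 (x1 x2 x4 x5 : ℝ) : ℝ := (x1 * x5 + x4) ^ 2 + x1 ^ 2 + x2 ^ 2 + 1

lemma lintegral_comp_quadratic_le {a : ℝ} (ha : 0 < a) (k b : ℝ) (g : ℝ → ENNReal) :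
    ∫⁻ u, g (a * (u + k) ^ 2 + b) ≤
      ∫⁻ t, g t * ENNReal.ofReal (1 / Real.sqrt (a * (t - b))) := by
  rw [lintegral_add_right_eq_self (fun u => g (a * u ^ 2 + b)) k]
  have half : ∀ S : Set ℝ, MeasurableSet S → (∀ u ∈ S, u ≠ 0) →
      Set.InjOn (fun u : ℝ => a * u ^ 2 + b) S →
      ∫⁻ u in S, g (a * u ^ 2 + b) ≤
        ∫⁻ t, g t * ENNReal.ofReal (1 / Real.sqrt (a * (t - b)) / 2) := by
    intro S hS hS0 hinj
    have hderiv : ∀ u ∈ S, HasDerivWithinAt (fun u : ℝ => a * u ^ 2 + b) (a * (2 * u)) S u := by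
      intro u _
      have h := (((hasDerivAt_id u).pow 2).const_mul a).add_const b
      simp only [id] at h
      refine (h.congr_deriv ?_).hasDerivWithinAt
      simp
    have key := lintegral_image_eq_lintegral_abs_deriv_mul hS hderiv hinj
      (fun t => g t * ENNReal.ofReal (1 / Real.sqrt (a * (t - b)) / 2))
    refine le_trans (le_of_eq ?_) (key.symm.le.trans (setLIntegral_le_lintegral _ _))
    refine setLIntegral_congr_fun hS ?_
    intro u hu
    have hu0 := abs_pos.2 (hS0 u hu)
    have h1 : Real.sqrt (a * (a * u ^ 2 + b - b)) = a * |u| := by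
      rw [show a * (a * u ^ 2 + b - b) = (a * |u|) ^ 2 by rw [mul_pow, sq_abs]; ring]
      exact Real.sqrt_sq (by positivity)
    have h2 : |a * (2 * u)| * (1 / (a * |u|) / 2) = 1 := by
      rw [abs_mul, abs_mul, abs_of_pos ha, abs_two]; field_simp
    simp only [h1]
    rw [mul_left_comm, ← ENNReal.ofReal_mul (abs_nonneg _), h2]
    simp
  have hpos := half (Set.Ioi 0) measurableSet_Ioi (fun u hu => ne_of_gt hu) (by
    intro u hu v hv h
    have h' : u ^ 2 = v ^ 2 := by
      have : a * u ^ 2 = a * v ^ 2 := by simpa using h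
      exact mul_left_cancel₀ ha.ne' this
    exact (sq_eq_sq₀ (le_of_lt hu) (le_of_lt hv)).1 h')
  have hneg := half (Set.Iio 0) measurableSet_Iio (fun u hu => ne_of_lt hu) (by
    intro u hu v hv h
    have h' : u ^ 2 = v ^ 2 := by
      have : a * u ^ 2 = a * v ^ 2 := by simpa using h
      exact mul_left_cancel₀ ha.ne' this
    simp only [Set.mem_Iio] at hu hv
    rcases sq_eq_sq_iff_eq_or_eq_neg.1 h' with h | h <;> linarith)
  have hsplit : ∫⁻ u, g (a * u ^ 2 + b) =
      (∫⁻ u in Set.Ioi 0, g (a * u ^ 2 + b)) + ∫⁻ u in Set.Iio 0, g (a * u ^ 2 + b) := by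
    rw [← lintegral_add_compl _ (measurableSet_Ioi (a := (0 : ℝ))), Set.compl_Ioi,
      setLIntegral_congr (Iio_ae_eq_Iic (μ := volume) (a := (0 : ℝ))).symm]
  rw [hsplit]
  refine (add_le_add hpos hneg).trans (le_of_eq ?_)
  rw [← two_mul, ← lintegral_const_mul' _ _ (by simp)]
  congr 1
  ext t
  rw [ENNReal.ofReal_div_of_pos two_pos, ENNReal.ofReal_ofNat, mul_left_comm,
    ENNReal.mul_div_cancel (by simp) (by simp)]

lemma exists_lintegral_abs_sub_rpow_le {β : ℝ} (h0 : 0 < β) (h1 : β < 1) :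
    ∃ C > (0 : ℝ), ∀ a b τ : ℝ, a < b →
      ∫⁻ x in Set.Ioo a b, ENNReal.ofReal (|x - τ| ^ (β - 1)) ≤
        ENNReal.ofReal (C * (b - a) ^ β) := by
  refine ⟨1 / β + 1 / β + 1, by positivity, fun a b τ hab => ?_⟩
  set L := b - a with hL
  have hL0 : 0 < L := sub_pos.2 hab
  set k : ℝ → ENNReal := (Set.Ioc 0 L).indicator (fun x => ENNReal.ofReal (x ^ (β - 1))) with hk
  have hkm : Measurable k := by
    refine Measurable.indicator ?_ measurableSet_Ioc
    fun_prop
  have hkint : ∫⁻ x, k x = ENNReal.ofReal (1 / β * L ^ β) := by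
    rw [hk, lintegral_indicator measurableSet_Ioc, ← ofReal_integral_eq_lintegral_ofReal]
    · rw [← intervalIntegral.integral_of_le hL0.le, integral_rpow (Or.inl (by linarith))]
      simp [Real.zero_rpow h0.ne', div_eq_inv_mul]
    · exact (intervalIntegrable_iff_integrableOn_Ioc_of_le hL0.le).1
        (intervalIntegral.intervalIntegrable_rpow' (by linarith))
    · filter_upwards [ae_restrict_mem measurableSet_Ioc] with x hx
      exact Real.rpow_nonneg hx.1.le _
  have hpt : ∀ x : ℝ, ENNReal.ofReal (|x - τ| ^ (β - 1)) ≤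
      k (x - τ) + k (τ - x) + ENNReal.ofReal (L ^ (β - 1)) := by
    intro x
    rcases le_or_gt L |x - τ| with h | h
    · refine le_add_left (ENNReal.ofReal_le_ofReal ?_)
      exact Real.rpow_le_rpow_of_nonpos hL0 h (by linarith)
    · rcases lt_trichotomy x τ with hx | hx | hx
      · have : |x - τ| = τ - x := by rw [abs_of_neg (by linarith)]; ring
        rw [this] at h ⊢
        refine le_add_right (le_add_left ?_)
        rw [hk, Set.indicator_of_mem (show τ - x ∈ Set.Ioc 0 L from ⟨by linarith, h.le⟩)]
      · simp [hx, Real.zero_rpow (by linarith : β - 1 ≠ 0)]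
      · have : |x - τ| = x - τ := abs_of_pos (by linarith)
        rw [this] at h ⊢
        refine le_add_right (le_add_right ?_)
        rw [hk, Set.indicator_of_mem (show x - τ ∈ Set.Ioc 0 L from ⟨by linarith, h.le⟩)]
  calc ∫⁻ x in Set.Ioo a b, ENNReal.ofReal (|x - τ| ^ (β - 1))
      ≤ ∫⁻ x in Set.Ioo a b, (k (x - τ) + k (τ - x) + ENNReal.ofReal (L ^ (β - 1))) :=
        lintegral_mono hpt
    _ = (∫⁻ x in Set.Ioo a b, k (x - τ)) + (∫⁻ x in Set.Ioo a b, k (τ - x)) +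
          ENNReal.ofReal (L ^ (β - 1)) * ENNReal.ofReal L := by
        rw [lintegral_add_left (by fun_prop), lintegral_add_left (by fun_prop),
          setLIntegral_const, Real.volume_Ioo]
    _ ≤ (∫⁻ x, k x) + (∫⁻ x, k x) + ENNReal.ofReal (L ^ (β - 1)) * ENNReal.ofReal L := by
        refine add_le_add (add_le_add ?_ ?_) le_rfl
        · exact (setLIntegral_le_lintegral _ _).trans (lintegral_sub_right_eq_self k τ).le
        · exact (setLIntegral_le_lintegral _ _).trans (lintegral_sub_left_eq_self k τ).le
    _ = ENNReal.ofReal ((1 / β + 1 / β + 1) * L ^ β) := by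
        rw [hkint, ← ENNReal.ofReal_mul (by positivity), ← ENNReal.ofReal_add (by positivity)
          (by positivity), ← ENNReal.ofReal_add (by positivity) (by positivity)]
        congr 1
        have : L ^ (β - 1) * L = L ^ β := by
          rw [← Real.rpow_add_one hL0.ne']; congr 1; ring
        rw [this]; ring

lemma rpow_neg_mul_rpow_neg_le {x z p q : ℝ} (hx : 0 < x) (hz : 0 ≤ z) (hp : 0 < p)
    (hq : 0 < q) : x ^ (-p) * z ^ (-q) ≤ x ^ (-p - q) + z ^ (-p - q) := by
  rcases hz.eq_or_lt with rfl | hz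
  · rw [Real.zero_rpow (by linarith : -q ≠ 0), Real.zero_rpow (by linarith : -p - q ≠ 0)]
    simpa using Real.rpow_nonneg hx.le _
  rw [sub_eq_add_neg, Real.rpow_add hx, Real.rpow_add hz]
  have h1 := Real.rpow_nonneg hx.le (-p)
  have h2 := Real.rpow_nonneg hx.le (-q)
  have h3 := Real.rpow_nonneg hz.le (-p)
  have h4 := Real.rpow_nonneg hz.le (-q)
  rcases le_total x z with h | h
  · have := Real.rpow_le_rpow_of_nonpos hx h (by linarith : -q ≤ 0)
    nlinarith [mul_le_mul_of_nonneg_left this h1, mul_nonneg h3 h4]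
  · have := Real.rpow_le_rpow_of_nonpos hz h (by linarith : -p ≤ 0)
    nlinarith [mul_le_mul_of_nonneg_right this h4, mul_nonneg h1 h2]

lemma exists_lintegral_three_rpow_le {η : ℝ} (h0 : 0 < η) (h1 : η ≤ 1 / 8) :
    ∃ C > (0 : ℝ), ∀ a b τ : ℝ, a < b →
      ∫⁻ x in Set.Ioo a b, ENNReal.ofReal
          ((x - a) ^ (2 * η - 1) * (b - x) ^ (-(1 / 2) : ℝ) * |x - τ| ^ (-η)) ≤
        ENNReal.ofReal (C * (b - a) ^ (η - 1 / 2)) := by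
  obtain ⟨C₁, hC₁, H₁⟩ := exists_lintegral_abs_sub_rpow_le h0 (by linarith)
  obtain ⟨C₂, hC₂, H₂⟩ := exists_lintegral_abs_sub_rpow_le
    (by linarith : 0 < 1 / 2 - η) (by linarith)
  refine ⟨(1 / 2) ^ (-(1 / 2) : ℝ) * (C₁ + C₁) + (1 / 2) ^ (2 * η - 1) * (C₂ + C₂),
    by positivity, fun a b τ hab => ?_⟩
  set L := b - a with hL
  have hL0 : 0 < L := sub_pos.2 hab
  have hpt : ∀ x ∈ Set.Ioo a b, ENNReal.ofReal
      ((x - a) ^ (2 * η - 1) * (b - x) ^ (-(1 / 2) : ℝ) * |x - τ| ^ (-η)) ≤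
      ENNReal.ofReal ((L / 2) ^ (-(1 / 2) : ℝ)) * (ENNReal.ofReal (|x - a| ^ (η - 1)) +
        ENNReal.ofReal (|x - τ| ^ (η - 1))) +
      ENNReal.ofReal ((L / 2) ^ (2 * η - 1)) * (ENNReal.ofReal (|x - b| ^ (1 / 2 - η - 1)) +
        ENNReal.ofReal (|x - τ| ^ (1 / 2 - η - 1))) := by
    intro x hx
    have hX : 0 < x - a := sub_pos.2 hx.1
    have hY : 0 < b - x := sub_pos.2 hx.2
    have ha : |x - a| = x - a := abs_of_pos hX
    have hb : |x - b| = b - x := by rw [abs_of_neg (by linarith)]; ring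
    rw [ha, hb, ← ENNReal.ofReal_add (by positivity) (by positivity),
      ← ENNReal.ofReal_add (by positivity) (by positivity),
      ← ENNReal.ofReal_mul (by positivity), ← ENNReal.ofReal_mul (by positivity),
      ← ENNReal.ofReal_add (by positivity) (by positivity)]
    refine ENNReal.ofReal_le_ofReal ?_
    rcases le_or_gt (L / 2) (b - x) with h | h
    · refine le_add_of_le_of_nonneg ?_ (by positivity)
      have e1 := Real.rpow_le_rpow_of_nonpos (by positivity) h (by norm_num : (-(1 / 2) : ℝ) ≤ 0)
      have e2 := rpow_neg_mul_rpow_neg_le hX (abs_nonneg (x - τ))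
        (by linarith : 0 < 1 - 2 * η) h0
      rw [show -(1 - 2 * η) - η = η - 1 by ring, neg_sub] at e2
      calc _ = (b - x) ^ (-(1 / 2) : ℝ) * ((x - a) ^ (2 * η - 1) * |x - τ| ^ (-η)) := by ring
        _ ≤ _ := by gcongr
    · refine le_add_of_nonneg_of_le (by positivity) ?_
      have e1 := Real.rpow_le_rpow_of_nonpos (by positivity) (by linarith : L / 2 ≤ x - a)
        (by linarith : 2 * η - 1 ≤ 0)
      have e2 := rpow_neg_mul_rpow_neg_le hY (abs_nonneg (x - τ)) (by norm_num : (0:ℝ) < 1 / 2) h0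
      rw [show -(1 / 2) - η = 1 / 2 - η - 1 by ring] at e2
      rw [mul_assoc]
      gcongr
  refine (setLIntegral_mono (by fun_prop) hpt).trans ?_
  rw [lintegral_add_left (by fun_prop), lintegral_const_mul _ (by fun_prop),
    lintegral_const_mul _ (by fun_prop), lintegral_add_left (by fun_prop),
    lintegral_add_left (by fun_prop)]
  calc _ ≤ ENNReal.ofReal ((L / 2) ^ (-(1 / 2) : ℝ)) * (ENNReal.ofReal (C₁ * L ^ η) +
        ENNReal.ofReal (C₁ * L ^ η)) +
      ENNReal.ofReal ((L / 2) ^ (2 * η - 1)) * (ENNReal.ofReal (C₂ * L ^ (1 / 2 - η)) +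
        ENNReal.ofReal (C₂ * L ^ (1 / 2 - η))) := by
        gcongr
        exacts [H₁ a b a hab, H₁ a b τ hab, H₂ a b b hab, H₂ a b τ hab]
    _ = _ := by
        rw [← ENNReal.ofReal_add (by positivity) (by positivity),
          ← ENNReal.ofReal_add (by positivity) (by positivity),
          ← ENNReal.ofReal_mul (by positivity), ← ENNReal.ofReal_mul (by positivity),
          ← ENNReal.ofReal_add (by positivity) (by positivity)]
        congr 1
        rw [div_eq_mul_one_div, Real.mul_rpow hL0.le (by norm_num),
          Real.mul_rpow hL0.le (by norm_num),
          show η - 1 / 2 = -(1 / 2) + η by ring, Real.rpow_add hL0,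
          show L ^ (2 * η - 1) = L ^ (-(1 / 2) : ℝ) * L ^ η * L ^ (-(1 / 2 - η)) by
            rw [← Real.rpow_add hL0, ← Real.rpow_add hL0]; congr 1; ring, Real.rpow_neg hL0.le (1 / 2 - η)]
        have : L ^ (1 / 2 - η) ≠ 0 := by positivity
        field_simp

lemma one_div_sqrt_eq_rpow {x : ℝ} (hx : 0 ≤ x) : 1 / Real.sqrt x = x ^ (-(1 / 2) : ℝ) := by
  rw [Real.rpow_neg hx, Real.sqrt_eq_rpow, one_div]

lemma rpow_neg_half_sub_le {l m x q d η : ℝ} (h0 : 0 < η) (h1 : η ≤ 1 / 8) (hlm : l < m)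
    (hmx : m < x) (hxq : x < q) (hld : l ≤ d) (hdm : d ≤ m) :
    (x - l) ^ (-(1 / 2) : ℝ) ≤
      (x - m) ^ (η - 1 / 2) * (q - m) ^ (1 / 2 - η) * (q - d) ^ (η - 1 / 2) * (m - l) ^ (-η) := by
  have hxl : 0 < x - l := by linarith
  have hxm : 0 < x - m := by linarith
  have hqm : 0 < q - m := by linarith
  have hqd : 0 < q - d := by linarith
  have hml : 0 < m - l := by linarith
  have e1 : (x - m) * (q - d) / (q - m) ≤ x - l := by
    rw [div_le_iff₀ hqm]
    nlinarith [mul_nonneg hxm.le (sub_nonneg.2 hld), mul_nonneg hml.le (sub_pos.2 hxq).le]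
  have e2 := Real.rpow_le_rpow_of_nonpos (by positivity) e1 (by linarith : η - 1 / 2 ≤ 0)
  have e3 := Real.rpow_le_rpow_of_nonpos hml (by linarith : m - l ≤ x - l)
    (by linarith : -η ≤ 0)
  rw [Real.div_rpow (by positivity) hqm.le, Real.mul_rpow hxm.le hqd.le] at e2
  rw [show (-(1 / 2) : ℝ) = (η - 1 / 2) + -η by ring, Real.rpow_add hxl,
    show 1 / 2 - η = -(η - 1 / 2) by ring, Real.rpow_neg hqm.le]
  refine (mul_le_mul e2 e3 (by positivity) (by positivity)).trans (le_of_eq ?_)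
  have : (q - m) ^ (η - 1 / 2) ≠ 0 := by positivity
  field_simp

lemma exists_inner_lintegral_le {η : ℝ} (h0 : 0 < η) (h1 : η ≤ 1 / 8) :
    ∃ C > (0 : ℝ), ∀ s t d : ℝ, 1 < d → d < s → 0 < t → d ≠ s / t →
      ∫⁻ x, ENNReal.ofReal (1 / Real.sqrt (d * s - x ^ 2)) *
          ENNReal.ofReal (1 / Real.sqrt (x * t - s)) * ENNReal.ofReal (1 / Real.sqrt (x - d)) ≤
        ENNReal.ofReal (C * (t ^ (-(1 / 2) : ℝ) * Real.sqrt (d * s) ^ (-(1 / 2) : ℝ) *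
          (Real.sqrt (d * s) - d) ^ (η - 1 / 2) * |d - s / t| ^ (-η))) := by
  obtain ⟨C, hC, H⟩ := exists_lintegral_three_rpow_le h0 h1
  refine ⟨C, hC, fun s t d hd hds ht hne => ?_⟩
  set τ := s / t with hτ
  set q := Real.sqrt (d * s) with hq
  have hq2 : q ^ 2 = d * s := Real.sq_sqrt (by nlinarith)
  have hdq : d < q := Real.lt_sqrt_of_sq_lt (by nlinarith)
  have hq0 : 0 < q := by linarith
  have key : ∀ l m : ℝ, l < m → l ≤ d → d ≤ m → τ ≤ m → (m = d ∨ m = τ) → m - l = |d - τ| →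
      (∀ x, (x - τ) * (x - d) = (x - m) * (x - l)) →
      ∫⁻ x, ENNReal.ofReal (1 / Real.sqrt (d * s - x ^ 2)) *
          ENNReal.ofReal (1 / Real.sqrt (x * t - s)) * ENNReal.ofReal (1 / Real.sqrt (x - d)) ≤
        ENNReal.ofReal (C * (t ^ (-(1 / 2) : ℝ) * q ^ (-(1 / 2) : ℝ) *
          (q - d) ^ (η - 1 / 2) * |d - τ| ^ (-η))) := by
    intro l m hlm hld hdm hτm hm hml hprod
    have hfac : ∀ x, x * t - s = t * (x - τ) := fun x => by rw [hτ]; field_simp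
    have hpt : ∀ x, ENNReal.ofReal (1 / Real.sqrt (d * s - x ^ 2)) *
          ENNReal.ofReal (1 / Real.sqrt (x * t - s)) * ENNReal.ofReal (1 / Real.sqrt (x - d)) ≤
        (Set.Ioo m q).indicator (fun x => ENNReal.ofReal (t ^ (-(1 / 2) : ℝ) * q ^ (-(1 / 2) : ℝ) *
          (q - m) ^ (1 / 2 - η) * (q - d) ^ (η - 1 / 2) * |d - τ| ^ (-η)) *
          ENNReal.ofReal ((x - m) ^ (2 * η - 1) * (q - x) ^ (-(1 / 2) : ℝ) *
            |x - m| ^ (-η))) x := by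
      intro x
      by_cases hx : x ∈ Set.Ioo m q
      · rw [Set.indicator_of_mem hx]
        obtain ⟨hmx, hxq⟩ := hx
        have hxm : 0 < x - m := by linarith
        have hqx : 0 < q - x := by linarith
        have hxl : 0 < x - l := by linarith
        have hxd : 0 < x - d := by linarith
        have hxτ : 0 < x - τ := by linarith
        have hqd : 0 < q - d := by linarith
        have hqm : 0 < q - m := by linarith
        have e0 : (q - x) * q ≤ d * s - x ^ 2 := by nlinarith
        have hpos : 0 < d * s - x ^ 2 := lt_of_lt_of_le (by positivity) e0
        rw [hfac, one_div_sqrt_eq_rpow hpos.le, one_div_sqrt_eq_rpow (by positivity),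
          one_div_sqrt_eq_rpow hxd.le, ← ENNReal.ofReal_mul (by positivity),
          ← ENNReal.ofReal_mul (by positivity), ← ENNReal.ofReal_mul (by positivity)]
        refine ENNReal.ofReal_le_ofReal ?_
        have e1 := Real.rpow_le_rpow_of_nonpos (by positivity) e0
          (by norm_num : (-(1 / 2) : ℝ) ≤ 0)
        rw [Real.mul_rpow hqx.le hq0.le] at e1
        have e2 := rpow_neg_half_sub_le h0 h1 hlm hmx hxq hld hdm
        rw [hml] at e2
        have e3 : (x - τ) ^ (-(1 / 2) : ℝ) * (x - d) ^ (-(1 / 2) : ℝ) =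
            (x - m) ^ (-(1 / 2) : ℝ) * (x - l) ^ (-(1 / 2) : ℝ) := by
          rw [← Real.mul_rpow hxτ.le hxd.le, hprod, Real.mul_rpow hxm.le hxl.le]
        have e4 : (x - m) ^ (-(1 / 2) : ℝ) * (x - m) ^ (η - 1 / 2) =
            (x - m) ^ (2 * η - 1) * |x - m| ^ (-η) := by
          rw [abs_of_pos hxm, ← Real.rpow_add hxm, ← Real.rpow_add hxm]
          congr 1; ring
        calc (d * s - x ^ 2) ^ (-(1 / 2) : ℝ) * (t * (x - τ)) ^ (-(1 / 2) : ℝ) *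
              (x - d) ^ (-(1 / 2) : ℝ)
            = (d * s - x ^ 2) ^ (-(1 / 2) : ℝ) * (t ^ (-(1 / 2) : ℝ) *
              ((x - m) ^ (-(1 / 2) : ℝ) * (x - l) ^ (-(1 / 2) : ℝ))) := by
              rw [← e3, Real.mul_rpow ht.le hxτ.le]; ring
          _ ≤ ((q - x) ^ (-(1 / 2) : ℝ) * q ^ (-(1 / 2) : ℝ)) * (t ^ (-(1 / 2) : ℝ) *
              ((x - m) ^ (-(1 / 2) : ℝ) * ((x - m) ^ (η - 1 / 2) * (q - m) ^ (1 / 2 - η) *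
                (q - d) ^ (η - 1 / 2) * |d - τ| ^ (-η)))) := by
              gcongr
          _ = (q - x) ^ (-(1 / 2) : ℝ) * q ^ (-(1 / 2) : ℝ) * (t ^ (-(1 / 2) : ℝ) *
              (((x - m) ^ (-(1 / 2) : ℝ) * (x - m) ^ (η - 1 / 2)) * (q - m) ^ (1 / 2 - η) *
                (q - d) ^ (η - 1 / 2) * |d - τ| ^ (-η))) := by ring
          _ = _ := by rw [e4]; ring
      · rw [Set.indicator_of_notMem hx, nonpos_iff_eq_zero]
        rcases le_or_gt x m with h | h
        · rcases hm with hm | hm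
          · have : Real.sqrt (x - d) = 0 := Real.sqrt_eq_zero_of_nonpos (by linarith)
            simp [this]
          · have : Real.sqrt (x * t - s) = 0 := Real.sqrt_eq_zero_of_nonpos (by
              rw [hfac]; nlinarith)
            simp [this]
        · have hqx : q ≤ x := by
            by_contra! h'
            exact hx ⟨h, h'⟩
          have : Real.sqrt (d * s - x ^ 2) = 0 := Real.sqrt_eq_zero_of_nonpos (by nlinarith)
          simp [this]
    refine (lintegral_mono hpt).trans ?_
    rw [lintegral_indicator measurableSet_Ioo]
    rcases lt_or_ge m q with hmq | hmq
    · have hqm : 0 < q - m := by linarith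
      have hqd : 0 < q - d := by linarith
      rw [lintegral_const_mul _ (by fun_prop)]
      refine (mul_le_mul_right (H m q m hmq) _).trans (le_of_eq ?_)
      rw [← ENNReal.ofReal_mul (by positivity)]
      congr 1
      have : (q - m) ^ (1 / 2 - η) * (q - m) ^ (η - 1 / 2) = 1 := by
        rw [← Real.rpow_add hqm]; simp
      linear_combination (C * (t ^ (-(1 / 2) : ℝ) * q ^ (-(1 / 2) : ℝ) *
          (q - d) ^ (η - 1 / 2) * |d - τ| ^ (-η))) * this
    · simp [Set.Ioo_eq_empty (not_lt.2 hmq)]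
  rcases lt_or_gt_of_ne hne with h | h
  · exact key d τ h le_rfl h.le le_rfl (Or.inr rfl)
      (by rw [abs_of_neg (by linarith)]; ring) (fun x => rfl)
  · exact key τ d h h.le le_rfl h.le (Or.inl rfl)
      (by rw [abs_of_pos (by linarith)]) (fun x => mul_comm _ _)

lemma sqrt_mul_rpow_le {η s d : ℝ} (h0 : 0 < η) (h1 : η ≤ 1 / 8) (hd : 1 < d) (hds : d < s) :
    Real.sqrt (d * s) ^ (-(1 / 2) : ℝ) * (Real.sqrt (d * s) - d) ^ (η - 1 / 2) *
        (d - 1) ^ (-(1 / 2) : ℝ) ≤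
      (1 / 2) ^ (-(1 / 2) : ℝ) * s ^ η * ((d - 1) ^ (2 * η - 1) * (s - d) ^ (-(1 / 2) : ℝ)) := by
  set q := Real.sqrt (d * s) with hq
  have hq2 : q ^ 2 = d * s := Real.sq_sqrt (by nlinarith)
  have hdq : d < q := Real.lt_sqrt_of_sq_lt (by nlinarith)
  have hqs : q < s := by nlinarith
  have hq0 : 0 < q := by linarith
  have hqd : 0 < q - d := by linarith
  have hd1 : 0 < d - 1 := by linarith
  have hsd : 0 < s - d := by linarith
  have hd0 : 0 < d := by linarith
  have e0 : 1 / 2 * (d * (s - d)) ≤ q * (q - d) := by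
    have : q ≤ (d + s) / 2 := by nlinarith [sq_nonneg (s - d)]
    nlinarith
  have e1 := Real.rpow_le_rpow_of_nonpos (by positivity) e0 (by norm_num : (-(1 / 2) : ℝ) ≤ 0)
  rw [Real.mul_rpow hq0.le hqd.le, Real.mul_rpow (by norm_num) (by positivity),
    Real.mul_rpow hd0.le hsd.le] at e1
  have e2 : (q - d) ^ η ≤ s ^ η := Real.rpow_le_rpow hqd.le (by linarith) h0.le
  have e3 : d ^ (-(1 / 2) : ℝ) ≤ (d - 1) ^ (2 * η - 1 / 2) :=
    (Real.rpow_le_rpow_of_exponent_le hd.le (by linarith)).trans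
      (Real.rpow_le_rpow_of_nonpos hd1 (by linarith) (by linarith))
  have e4 := e1.trans (mul_le_mul_of_nonneg_left
    (mul_le_mul_of_nonneg_right e3 (by positivity)) (by positivity))
  rw [show η - 1 / 2 = -(1 / 2) + η by ring, Real.rpow_add hqd,
    show 2 * η - 1 = (2 * η - 1 / 2) + -(1 / 2) by ring, Real.rpow_add hd1]
  calc _ = (q ^ (-(1 / 2) : ℝ) * (q - d) ^ (-(1 / 2) : ℝ)) * (q - d) ^ η *
        (d - 1) ^ (-(1 / 2) : ℝ) := by ring
    _ ≤ ((1 / 2) ^ (-(1 / 2) : ℝ) * ((d - 1) ^ (2 * η - 1 / 2) * (s - d) ^ (-(1 / 2) : ℝ))) *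
        s ^ η * (d - 1) ^ (-(1 / 2) : ℝ) := by
        gcongr
    _ = _ := by ring

lemma exists_double_lintegral_le {η : ℝ} (h0 : 0 < η) (h1 : η ≤ 1 / 8) :
    ∃ C > (0 : ℝ), ∀ s t : ℝ, 2 ≤ s → 0 < t →
      ∫⁻ d, (∫⁻ x, ENNReal.ofReal (1 / Real.sqrt (d * s - x ^ 2)) *
          ENNReal.ofReal (1 / Real.sqrt (x * t - s)) * ENNReal.ofReal (1 / Real.sqrt (x - d))) *
          ENNReal.ofReal (1 / Real.sqrt (d - 1)) ≤
        ENNReal.ofReal (C * (t ^ (-(1 / 2) : ℝ) * s ^ (2 * η - 1 / 2))) := by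
  obtain ⟨C₁, hC₁, H₁⟩ := exists_inner_lintegral_le h0 h1
  obtain ⟨C₂, hC₂, H₂⟩ := exists_lintegral_three_rpow_le h0 h1
  refine ⟨C₁ * (1 / 2) ^ (-(1 / 2) : ℝ) * C₂ * (1 / 2) ^ (η - 1 / 2), by positivity,
    fun s t hs ht => ?_⟩
  have hs0 : 0 < s := by linarith
  have hpt : ∀ d, d ≠ s / t →
      (∫⁻ x, ENNReal.ofReal (1 / Real.sqrt (d * s - x ^ 2)) *
          ENNReal.ofReal (1 / Real.sqrt (x * t - s)) * ENNReal.ofReal (1 / Real.sqrt (x - d))) *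
          ENNReal.ofReal (1 / Real.sqrt (d - 1)) ≤
      (Set.Ioo 1 s).indicator (fun d => ENNReal.ofReal (C₁ * (1 / 2) ^ (-(1 / 2) : ℝ) *
        t ^ (-(1 / 2) : ℝ) * s ^ η) * ENNReal.ofReal ((d - 1) ^ (2 * η - 1) *
          (s - d) ^ (-(1 / 2) : ℝ) * |d - s / t| ^ (-η))) d := by
    intro d hne
    by_cases hd : d ∈ Set.Ioo 1 s
    · rw [Set.indicator_of_mem hd]
      obtain ⟨hd, hds⟩ := hd
      have hd1 : 0 < d - 1 := by linarith
      have hsd : 0 < s - d := by linarith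
      have hdq : d < Real.sqrt (d * s) := Real.lt_sqrt_of_sq_lt (by nlinarith)
      have hqd : 0 < Real.sqrt (d * s) - d := by linarith
      refine (mul_le_mul_left (H₁ s t d hd hds ht hne) _).trans ?_
      rw [one_div_sqrt_eq_rpow hd1.le, ← ENNReal.ofReal_mul (by positivity),
        ← ENNReal.ofReal_mul (by positivity)]
      refine ENNReal.ofReal_le_ofReal ?_
      have e := sqrt_mul_rpow_le h0 h1 hd hds
      calc _ = C₁ * t ^ (-(1 / 2) : ℝ) * |d - s / t| ^ (-η) *
            (Real.sqrt (d * s) ^ (-(1 / 2) : ℝ) * (Real.sqrt (d * s) - d) ^ (η - 1 / 2) *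
              (d - 1) ^ (-(1 / 2) : ℝ)) := by ring
        _ ≤ C₁ * t ^ (-(1 / 2) : ℝ) * |d - s / t| ^ (-η) *
            ((1 / 2) ^ (-(1 / 2) : ℝ) * s ^ η *
              ((d - 1) ^ (2 * η - 1) * (s - d) ^ (-(1 / 2) : ℝ))) := by gcongr
        _ = _ := by ring
    · rw [Set.indicator_of_notMem hd, nonpos_iff_eq_zero]
      rcases le_or_gt d 1 with h | h
      · have : Real.sqrt (d - 1) = 0 := Real.sqrt_eq_zero_of_nonpos (by linarith)
        simp [this]
      · have hsd : s ≤ d := by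
          by_contra! h'
          exact hd ⟨h, h'⟩
        have hz : ∀ x, ENNReal.ofReal (1 / Real.sqrt (d * s - x ^ 2)) *
          ENNReal.ofReal (1 / Real.sqrt (x * t - s)) *
            ENNReal.ofReal (1 / Real.sqrt (x - d)) = 0 := by
          intro x
          rcases le_or_gt x d with hx | hx
          · have : Real.sqrt (x - d) = 0 := Real.sqrt_eq_zero_of_nonpos (by linarith)
            simp [this]
          · have : Real.sqrt (d * s - x ^ 2) = 0 := Real.sqrt_eq_zero_of_nonpos (by nlinarith)
            simp [this]
        rw [lintegral_congr hz]
        simp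
  have hae : ∀ᵐ d : ℝ, d ≠ s / t := by simp [ae_iff]
  refine (lintegral_mono_ae (hae.mono hpt)).trans ?_
  rw [lintegral_indicator measurableSet_Ioo, lintegral_const_mul _ (by fun_prop)]
  refine (mul_le_mul_right (H₂ 1 s (s / t) (by linarith)) _).trans ?_
  rw [← ENNReal.ofReal_mul (by positivity)]
  refine ENNReal.ofReal_le_ofReal ?_
  have e := Real.rpow_le_rpow_of_nonpos (by positivity) (by linarith : 1 / 2 * s ≤ s - 1)
    (by linarith : η - 1 / 2 ≤ 0)
  rw [Real.mul_rpow (by norm_num) hs0.le] at e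
  rw [show 2 * η - 1 / 2 = η + (η - 1 / 2) by ring, Real.rpow_add hs0]
  calc _ ≤ C₁ * (1 / 2) ^ (-(1 / 2) : ℝ) * t ^ (-(1 / 2) : ℝ) * s ^ η *
        (C₂ * ((1 / 2) ^ (η - 1 / 2) * s ^ (η - 1 / 2))) := by gcongr
    _ = _ := by ring

/-- The density of the pair `(ξw1, ξw2)` at `(s, t)`, over the coordinates `(x4, x5)`. -/
def tubeDensity (p : ℝ × ℝ) (s t : ℝ) : ENNReal :=
  ENNReal.ofReal (1 / Real.sqrt ((1 + p.2 ^ 2) * s - (1 + p.2 ^ 2 + p.1 ^ 2) ^ 2)) *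
    ENNReal.ofReal (1 / Real.sqrt ((1 + p.2 ^ 2 + p.1 ^ 2) * t - s))

lemma exists_lintegral_tubeDensity_le {η : ℝ} (h0 : 0 < η) (h1 : η ≤ 1 / 8) :
    ∃ C > (0 : ℝ), ∀ s t : ℝ, 2 ≤ s → 0 < t →
      ∫⁻ p, tubeDensity p s t ≤
        ENNReal.ofReal (C * (t ^ (-(1 / 2) : ℝ) * s ^ (2 * η - 1 / 2))) := by
  obtain ⟨C, hC, H⟩ := exists_double_lintegral_le h0 h1
  refine ⟨C, hC, fun s t hs ht => le_trans ?_ (H s t hs ht)⟩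
  rw [Measure.volume_eq_prod, lintegral_prod_symm _ (by unfold tubeDensity; fun_prop)]
  have inner : ∀ d : ℝ, ∫⁻ x : ℝ, ENNReal.ofReal (1 / Real.sqrt (d * s - (d + x ^ 2) ^ 2)) *
      ENNReal.ofReal (1 / Real.sqrt ((d + x ^ 2) * t - s)) ≤
      ∫⁻ x, ENNReal.ofReal (1 / Real.sqrt (d * s - x ^ 2)) *
          ENNReal.ofReal (1 / Real.sqrt (x * t - s)) *
            ENNReal.ofReal (1 / Real.sqrt (x - d)) := by
    intro d
    simpa [add_comm] using lintegral_comp_quadratic_le one_pos 0 d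
      (fun x => ENNReal.ofReal (1 / Real.sqrt (d * s - x ^ 2)) *
        ENNReal.ofReal (1 / Real.sqrt (x * t - s)))
  refine (lintegral_mono fun y => inner (1 + y ^ 2)).trans ?_
  simpa [add_comm] using lintegral_comp_quadratic_le one_pos 0 1
    (fun d => ∫⁻ x, ENNReal.ofReal (1 / Real.sqrt (d * s - x ^ 2)) *
          ENNReal.ofReal (1 / Real.sqrt (x * t - s)) *
            ENNReal.ofReal (1 / Real.sqrt (x - d)))

lemma ξw1_completed_square (x y x4 x5 : ℝ) :
    ξw1 x (x * x4 - y) x4 x5 = (1 + x5 ^ 2) * (y + x4 ^ 2 * x5 / (1 + x5 ^ 2)) ^ 2 +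
      (1 + x5 ^ 2 + x4 ^ 2) ^ 2 / (1 + x5 ^ 2) := by
  have : 1 + x5 ^ 2 ≠ 0 := by positivity
  unfold ξw1
  field_simp
  ring

lemma ξw2_completed_square (x y x4 x5 : ℝ) :
    ξw2 x (x * x4 - y) x4 x5 =
      (1 + x5 ^ 2 + x4 ^ 2) * (x + x4 * (x5 - y) / (1 + x5 ^ 2 + x4 ^ 2)) ^ 2 +
      ξw1 x (x * x4 - y) x4 x5 / (1 + x5 ^ 2 + x4 ^ 2) := by
  have : 1 + x5 ^ 2 + x4 ^ 2 ≠ 0 := by positivity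
  unfold ξw2 ξw1
  field_simp
  ring

lemma lintegral_last_pair_first (F : ℝ × ℝ × ℝ × ℝ → ENNReal) (hF : Measurable F) :
    ∫⁻ z, F z = ∫⁻ p : ℝ × ℝ, ∫⁻ x, ∫⁻ y, F (x, y, p) := by
  rw [Measure.volume_eq_prod, lintegral_prod _ hF.aemeasurable]
  have h : ∀ x : ℝ, ∫⁻ w : ℝ × ℝ × ℝ, F (x, w) = ∫⁻ p : ℝ × ℝ, ∫⁻ y, F (x, y, p) := by
    intro x
    rw [Measure.volume_eq_prod, lintegral_prod_symm _ (by fun_prop)]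
  rw [lintegral_congr h, lintegral_lintegral_swap]
  refine Measurable.aemeasurable ?_
  exact Measurable.lintegral_prod_right' (f := fun z : (ℝ × ℝ × ℝ) × ℝ => F (z.1.1, z.2, z.1.2))
    (by fun_prop)

lemma lintegral_fiber_le {f₁ f₂ : ℝ → ENNReal} (h₁ : Measurable f₁) (h₂ : Measurable f₂)
    (p : ℝ × ℝ) :
    ∫⁻ x, ∫⁻ y, f₁ (ξw1 x y p.1 p.2) * f₂ (ξw2 x y p.1 p.2) ≤
      ∫⁻ s, ∫⁻ t, f₁ s * f₂ t * tubeDensity p s t := by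
  obtain ⟨x4, x5⟩ := p
  set D := 1 + x5 ^ 2 with hD
  set A := D + x4 ^ 2 with hA
  have hD0 : 0 < D := by positivity
  have hA0 : 0 < A := by positivity
  have hm₁ : Measurable fun z : ℝ × ℝ => ξw1 z.1 z.2 x4 x5 := by unfold ξw1; fun_prop
  have hm₂ : Measurable fun z : ℝ × ℝ => ξw2 z.1 z.2 x4 x5 := by unfold ξw2; fun_prop
  set φ : ℝ → ℝ := fun y => D * (y + x4 ^ 2 * x5 / D) ^ 2 + A ^ 2 / D with hφ
  set G : ℝ → ENNReal := fun s => f₁ s * ∫⁻ t, f₂ t * ENNReal.ofReal (1 / Real.sqrt (A * t - s))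
    with hG
  calc ∫⁻ x, ∫⁻ y, f₁ (ξw1 x y x4 x5) * f₂ (ξw2 x y x4 x5)
      = ∫⁻ x, ∫⁻ y, f₁ (ξw1 x (x * x4 - y) x4 x5) * f₂ (ξw2 x (x * x4 - y) x4 x5) :=
        lintegral_congr fun x => (lintegral_sub_left_eq_self
          (fun y => f₁ (ξw1 x y x4 x5) * f₂ (ξw2 x y x4 x5)) (x * x4)).symm
    _ = ∫⁻ y, ∫⁻ x, f₁ (ξw1 x (x * x4 - y) x4 x5) * f₂ (ξw2 x (x * x4 - y) x4 x5) := by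
        refine lintegral_lintegral_swap (Measurable.aemeasurable ?_)
        have hs : Measurable fun z : ℝ × ℝ => (z.1, z.1 * x4 - z.2) := by fun_prop
        exact (h₁.comp (hm₁.comp hs)).mul (h₂.comp (hm₂.comp hs))
    _ ≤ ∫⁻ y, G (φ y) := by
        refine lintegral_mono fun y => ?_
        have e : ∀ x, f₁ (ξw1 x (x * x4 - y) x4 x5) * f₂ (ξw2 x (x * x4 - y) x4 x5) =
            f₁ (φ y) * f₂ (A * (x + x4 * (x5 - y) / A) ^ 2 + φ y / A) := by
          intro x
          rw [ξw2_completed_square, ξw1_completed_square]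
        rw [lintegral_congr e, lintegral_const_mul _ (by fun_prop)]
        refine mul_le_mul_right ((lintegral_comp_quadratic_le hA0 _ _ f₂).trans (le_of_eq ?_)) _
        refine lintegral_congr fun t => ?_
        rw [mul_sub, mul_div_cancel₀ _ hA0.ne']
    _ ≤ ∫⁻ s, G s * ENNReal.ofReal (1 / Real.sqrt (D * (s - A ^ 2 / D))) :=
        lintegral_comp_quadratic_le hD0 _ _ G
    _ = ∫⁻ s, ∫⁻ t, f₁ s * f₂ t * tubeDensity (x4, x5) s t := by
        refine lintegral_congr fun s => ?_
        rw [mul_sub, mul_div_cancel₀ _ hD0.ne']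
        simp only [hG]
        rw [← lintegral_const_mul _ (by fun_prop), ← lintegral_mul_const _ (by fun_prop)]
        refine lintegral_congr fun t => ?_
        unfold tubeDensity
        ring

lemma volume_tube_le_s16 {S T : Set ℝ} (hS : MeasurableSet S) (hT : MeasurableSet T) :
    volume {x : ℝ × ℝ × ℝ × ℝ | ξw1 x.1 x.2.1 x.2.2.1 x.2.2.2 ∈ S ∧
        ξw2 x.1 x.2.1 x.2.2.1 x.2.2.2 ∈ T} ≤
      ∫⁻ s in S, ∫⁻ t in T, ∫⁻ p, tubeDensity p s t := by
  have hf₁ : Measurable (S.indicator (1 : ℝ → ENNReal)) := measurable_one.indicator hS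
  have hf₂ : Measurable (T.indicator (1 : ℝ → ENNReal)) := measurable_one.indicator hT
  have hm₁ : Measurable fun x : ℝ × ℝ × ℝ × ℝ => ξw1 x.1 x.2.1 x.2.2.1 x.2.2.2 := by
    unfold ξw1; fun_prop
  have hm₂ : Measurable fun x : ℝ × ℝ × ℝ × ℝ => ξw2 x.1 x.2.1 x.2.2.1 x.2.2.2 := by
    unfold ξw2; fun_prop
  refine (lintegral_indicator_one ((hm₁ hS).inter (hm₂ hT))).symm.trans_le ?_
  calc _ = ∫⁻ x : ℝ × ℝ × ℝ × ℝ, S.indicator 1 (ξw1 x.1 x.2.1 x.2.2.1 x.2.2.2) *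
          T.indicator 1 (ξw2 x.1 x.2.1 x.2.2.1 x.2.2.2) := by
        refine lintegral_congr fun x => ?_
        rw [Set.inter_indicator_one]
        rfl
    _ = ∫⁻ p : ℝ × ℝ, ∫⁻ x, ∫⁻ y, S.indicator 1 (ξw1 x y p.1 p.2) *
          T.indicator 1 (ξw2 x y p.1 p.2) :=
        lintegral_last_pair_first _ ((hf₁.comp hm₁).mul (hf₂.comp hm₂))
    _ ≤ ∫⁻ p : ℝ × ℝ, ∫⁻ s, ∫⁻ t, S.indicator 1 s * T.indicator 1 t * tubeDensity p s t :=
        lintegral_mono fun p => lintegral_fiber_le hf₁ hf₂ p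
    _ = ∫⁻ p : ℝ × ℝ, ∫⁻ s in S, ∫⁻ t in T, tubeDensity p s t := by
        refine lintegral_congr fun p => ?_
        rw [← lintegral_indicator hS]
        refine lintegral_congr fun s => ?_
        by_cases hs : s ∈ S
        · simp only [Set.indicator_of_mem hs, ← lintegral_indicator hT]
          refine lintegral_congr fun t => ?_
          by_cases ht : t ∈ T <;> simp [ht]
        · simp [hs]
    _ = ∫⁻ s in S, ∫⁻ p : ℝ × ℝ, ∫⁻ t in T, tubeDensity p s t := by
        have hm : Measurable fun z : (ℝ × ℝ) × ℝ => ∫⁻ t in T, tubeDensity z.1 z.2 t := by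
          refine Measurable.lintegral_prod_right'
            (f := fun z : ((ℝ × ℝ) × ℝ) × ℝ => tubeDensity z.1.1 z.1.2 z.2) ?_
          unfold tubeDensity
          fun_prop
        exact lintegral_lintegral_swap hm.aemeasurable
    _ = _ := by
        refine lintegral_congr fun s => ?_
        have hm : Measurable fun z : (ℝ × ℝ) × ℝ => tubeDensity z.1 s z.2 := by
          unfold tubeDensity; fun_prop
        exact lintegral_lintegral_swap hm.aemeasurable

/-- the tube-volume bound for the long Weyl element `w0`. -/
theorem tube_volume_w0 (a1 a2 ε : ℝ) (ha1 : 0 < a1) (ha2 : 0 < a2) (hε : 0 < ε) :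
    ∃ Z0 ≥ (1:ℝ), ∃ K > (0:ℝ), ∀ Z1 Z2 R1 R2 : ℝ,
      Z0 ≤ Z1 → Z0 ≤ Z2 → Z0 ≤ R1 → Z0 ≤ R2 →
      volume {x : ℝ × ℝ × ℝ × ℝ |
          |ξw1 x.1 x.2.1 x.2.2.1 x.2.2.2 - Z1| ≤ a1 * Z1 / R1 ∧
          |ξw2 x.1 x.2.1 x.2.2.1 x.2.2.2 - Z2| ≤ a2 * Z2 / R2} ≤
        ENNReal.ofReal
          (K * Real.sqrt (Z1 * Z2) / (R1 * R2) * (Z1 * Z2 * R1 * R2) ^ ε) := by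
  set η := min (ε / 2) (1 / 8) with hη
  have h0 : 0 < η := by positivity
  have h1 : η ≤ 1 / 8 := min_le_right _ _
  have h2 : 2 * η ≤ ε := by have := min_le_left (ε / 2) (1 / 8); linarith
  obtain ⟨C, hC, H⟩ := exists_lintegral_tubeDensity_le h0 h1
  refine ⟨4 + 2 * a1 + 2 * a2, by linarith,
    4 * a1 * a2 * C * (1 / 2) ^ (-(1 / 2) : ℝ) * (1 / 2) ^ (2 * η - 1 / 2), by positivity,
    fun Z1 Z2 R1 R2 hZ1 hZ2 hR1 hR2 => ?_⟩
  have pZ1 : 0 < Z1 := by linarith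
  have pZ2 : 0 < Z2 := by linarith
  have pR1 : 0 < R1 := by linarith
  have pR2 : 0 < R2 := by linarith
  set δ1 := a1 * Z1 / R1 with hδ1
  set δ2 := a2 * Z2 / R2 with hδ2
  have hδ1Z : δ1 ≤ 1 / 2 * Z1 := by rw [hδ1, div_le_iff₀ pR1]; nlinarith
  have hδ2Z : δ2 ≤ 1 / 2 * Z2 := by rw [hδ2, div_le_iff₀ pR2]; nlinarith
  have hδ1p : 0 < δ1 := by positivity
  have hδ2p : 0 < δ2 := by positivity
  set B := C * ((1 / 2 * Z2) ^ (-(1 / 2) : ℝ) * (1 / 2 * Z1) ^ (2 * η - 1 / 2)) with hB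
  have hB0 : 0 < B := by positivity
  have hset : {x : ℝ × ℝ × ℝ × ℝ |
          |ξw1 x.1 x.2.1 x.2.2.1 x.2.2.2 - Z1| ≤ δ1 ∧
          |ξw2 x.1 x.2.1 x.2.2.1 x.2.2.2 - Z2| ≤ δ2} =
      {x : ℝ × ℝ × ℝ × ℝ | ξw1 x.1 x.2.1 x.2.2.1 x.2.2.2 ∈ Set.Icc (Z1 - δ1) (Z1 + δ1) ∧
        ξw2 x.1 x.2.1 x.2.2.1 x.2.2.2 ∈ Set.Icc (Z2 - δ2) (Z2 + δ2)} := by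
    ext x
    simp only [Set.mem_ofPred_eq, Set.mem_Icc_iff_abs_le, abs_sub_comm]
  rw [hset]
  calc _ ≤ ∫⁻ s in Set.Icc (Z1 - δ1) (Z1 + δ1), ∫⁻ t in Set.Icc (Z2 - δ2) (Z2 + δ2),
          ∫⁻ p, tubeDensity p s t := volume_tube_le_s16 measurableSet_Icc measurableSet_Icc
    _ ≤ ∫⁻ _ in Set.Icc (Z1 - δ1) (Z1 + δ1), ∫⁻ _ in Set.Icc (Z2 - δ2) (Z2 + δ2),
          ENNReal.ofReal B := by
        refine setLIntegral_mono (by fun_prop) fun s hs => ?_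
        refine setLIntegral_mono (by fun_prop) fun t ht => ?_
        have hsZ : 1 / 2 * Z1 ≤ s := by linarith [hs.1]
        have htZ : 1 / 2 * Z2 ≤ t := by linarith [ht.1]
        refine (H s t (by linarith) (by linarith)).trans (ENNReal.ofReal_le_ofReal ?_)
        have e1 := Real.rpow_le_rpow_of_nonpos (by positivity) hsZ
          (by linarith : 2 * η - 1 / 2 ≤ 0)
        have e2 := Real.rpow_le_rpow_of_nonpos (by positivity) htZ
          (by norm_num : (-(1 / 2) : ℝ) ≤ 0)
        have ht0 : 0 < t := by linarith
        have hs0 : 0 < s := by linarith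
        rw [hB]
        gcongr
    _ = ENNReal.ofReal (B * (2 * δ2) * (2 * δ1)) := by
        rw [setLIntegral_const, setLIntegral_const, Real.volume_Icc, Real.volume_Icc,
          show Z1 + δ1 - (Z1 - δ1) = 2 * δ1 by ring, show Z2 + δ2 - (Z2 - δ2) = 2 * δ2 by ring,
          ← ENNReal.ofReal_mul (by positivity), ← ENNReal.ofReal_mul (by positivity)]
    _ ≤ _ := by
        refine ENNReal.ofReal_le_ofReal ?_
        have hone : 1 ≤ Z2 * R1 * R2 := by
          have := one_le_mul_of_one_le_of_one_le (by linarith : 1 ≤ Z2) (by linarith : 1 ≤ R1)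
          exact one_le_mul_of_one_le_of_one_le this (by linarith)
        have e1 : Z1 ^ (2 * η) ≤ (Z1 * Z2 * R1 * R2) ^ ε := by
          refine (Real.rpow_le_rpow_of_exponent_le (by linarith) h2).trans
            (Real.rpow_le_rpow pZ1.le ?_ hε.le)
          rw [show Z1 * Z2 * R1 * R2 = Z1 * (Z2 * R1 * R2) by ring]
          exact le_mul_of_one_le_right pZ1.le hone
        have r : ∀ Z : ℝ, 0 < Z → Z * Z ^ (-(1 / 2) : ℝ) = Real.sqrt Z := by
          intro Z hZ
          rw [Real.sqrt_eq_rpow, mul_comm, ← Real.rpow_add_one hZ.ne']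
          norm_num
        rw [hB, Real.mul_rpow (by norm_num) pZ2.le, Real.mul_rpow (by norm_num) pZ1.le,
          Real.sqrt_mul pZ1.le, ← r Z1 pZ1, ← r Z2 pZ2, hδ1, hδ2]
        have hsplit : Z1 ^ (2 * η - 1 / 2) = Z1 ^ (-(1 / 2) : ℝ) * Z1 ^ (2 * η) := by
          rw [← Real.rpow_add pZ1]; congr 1; ring
        calc _ = 4 * a1 * a2 * C * (1 / 2) ^ (-(1 / 2) : ℝ) * (1 / 2) ^ (2 * η - 1 / 2) *
              (Z1 * Z1 ^ (-(1 / 2) : ℝ) * (Z2 * Z2 ^ (-(1 / 2) : ℝ))) / (R1 * R2) *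
              Z1 ^ (2 * η) := by
              rw [hsplit]; field_simp; ring
          _ ≤ _ := by gcongr

end
end
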